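/- arXiv:1709.07475 — 2 statements merged into one kernel-verified Lean document; each statement's English description precedes it below -/
import Mathlib

section
/- Let N be a positive integer, let k ≥ 2 be an even integer, and set B(N,k) = (Nk/12)·∏_{p prime, p ∣ N} (1 + 1/p). Then the ℂ-vector space M_k(Γ0(N)) is finite dimensional and dim_ℂ M_k(Γ0(N)) ≤ B(N,k) + 1, i.e. dim_ℂ M_k(Γ0(N)) ≤ ⌊B(N,k)⌋ + 1. -/
open CongruenceSubgroup

section

open UpperHalfPlane
open scoped ModularForm MatrixGroups

variable {𝒢 ℋ : Subgroup (GL (Fin 2) ℝ)} {k : ℤ}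

open SlashInvariantForm Classical in
/-- The product of the translates of `f` by the nontrivial cosets in `ℋ ⧸ 𝒢`, so that the norm of
`f` is the product of `f` and its norm cofactor. -/
noncomputable def ModularForm.normCofactor (hle : 𝒢 ≤ ℋ) [𝒢.IsFiniteRelIndex ℋ]
    [ℋ.HasDetPlusMinusOne] (f : ModularForm 𝒢 k) :
    letI := Fintype.ofFinite (ℋ ⧸ 𝒢.subgroupOf ℋ)
    ModularForm 𝒢 (k * ((Finset.univ : Finset (ℋ ⧸ 𝒢.subgroupOf ℋ)).erase (1 : ℋ)).card) :=
  letI := Fintype.ofFinite (ℋ ⧸ 𝒢.subgroupOf ℋ)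
  { toFun := ∏ q ∈ (Finset.univ : Finset (ℋ ⧸ 𝒢.subgroupOf ℋ)).erase (1 : ℋ), quotientFunc f q
    slash_action_eq' := fun h hh ↦ by
      rw [ModularForm.prod_slash, Subgroup.HasDetPlusMinusOne.abs_det (hle hh), one_zpow, one_smul]
      have hfix : (⟨h, hle hh⟩ : ℋ)⁻¹ • ((1 : ℋ) : ℋ ⧸ 𝒢.subgroupOf ℋ) =
          ((1 : ℋ) : ℋ ⧸ 𝒢.subgroupOf ℋ) := by
        refine QuotientGroup.eq.mpr ?_
        simpa [Subgroup.mem_subgroupOf] using hh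
      simp_rw [quotientFunc_smul f (hle hh)]
      refine Finset.prod_equiv (MulAction.toPerm (⟨h, hle hh⟩ : ℋ)⁻¹) (fun q ↦ ?_) (fun q _ ↦ rfl)
      simp only [Finset.mem_erase, Finset.mem_univ, and_true, MulAction.toPerm_apply]
      rw [not_iff_not]
      conv_rhs => rw [← hfix]
      exact (MulAction.injective _).eq_iff.symm
    holo' := .prod (Quotient.forall.mpr fun r _ ↦ (translate f r.val⁻¹).holo')
    bdd_at_cusps' := fun {c} hc γ ↦ by
      rintro rfl
      rw [IsBoundedAtImInfty, Filter.BoundedAtFilter, ModularForm.prod_slash]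
      apply Asymptotics.IsBigO.const_smul_left
      rw [show (1 : ℍ → ℝ) = fun x ↦ ∏ i ∈
        (Finset.univ : Finset (ℋ ⧸ 𝒢.subgroupOf ℋ)).erase (1 : ℋ), 1 by ext; simp,
        Finset.prod_fn]
      refine .finsetProd (Quotient.forall.mpr fun ⟨r, hr⟩ _ ↦
        (translate f _).bdd_at_cusps' ?_ γ rfl)
      simpa using (hc.mono hle).of_isFiniteRelIndex_conj hr }

lemma ModularForm.coe_norm_eq_mul_normCofactor (hle : 𝒢 ≤ ℋ) [𝒢.IsFiniteRelIndex ℋ]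
    [ℋ.HasDetPlusMinusOne] (f : ModularForm 𝒢 k) :
    (ModularForm.norm ℋ f : ℍ → ℂ) = f * normCofactor hle f := by
  classical
  let := Fintype.ofFinite (ℋ ⧸ 𝒢.subgroupOf ℋ)
  rw [ModularForm.coe_norm]
  refine (Finset.mul_prod_erase Finset.univ _
    (Finset.mem_univ ((1 : ℋ) : ℋ ⧸ 𝒢.subgroupOf ℋ))).symm.trans ?_
  congr 1
  exact (SlashInvariantForm.quotientFunc_mk f (1 : ℋ)).trans (by simp)

lemma ModularForm.order_qExpansion_le_norm (hle : 𝒢 ≤ ℋ) [𝒢.IsFiniteRelIndex ℋ]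
    [ℋ.HasDetPlusMinusOne] {h : ℝ} (hh : 0 < h) (hΓ : h ∈ 𝒢.strictPeriods) (f : ModularForm 𝒢 k) :
    (qExpansion h f).order ≤ (qExpansion h (ModularForm.norm ℋ f)).order := by
  rw [coe_norm_eq_mul_normCofactor hle, ModularForm.qExpansion_mul_coe hh hΓ,
    PowerSeries.order_mul]
  exact le_self_add

/-- **Sturm bound** for subgroups of `SL(2, ℤ)` containing the translation by `1`. -/
lemma ModularForm.eq_zero_of_lt_order [𝒢.IsArithmetic] (hle : 𝒢 ≤ 𝒮ℒ) (hΓ : 1 ∈ 𝒢.strictPeriods)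
    (f : ModularForm 𝒢 k)
    (hf : (((k * 𝒢.relIndex 𝒮ℒ).toNat / 12 : ℕ) : ℕ∞) < (qExpansion 1 f).order) : f = 0 := by
  have := sturm_bound_levelOne (f := ModularForm.norm 𝒮ℒ f)
    (hf.trans_le (order_qExpansion_le_norm hle one_pos hΓ f))
  simpa [ModularForm.norm_eq_zero_iff] using this

/-- The linear map sending a modular form to its first `n` Fourier coefficients. -/
noncomputable def ModularForm.truncatedQExpansion [𝒢.HasDetOne]
    (hΓ : 1 ∈ 𝒢.strictPeriods) (k : ℤ) (n : ℕ) :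
    ModularForm 𝒢 k →ₗ[ℂ] (Fin n → ℂ) where
  toFun f i := (qExpansion 1 f).coeff i
  map_add' f g := by
    ext i
    simp [ModularForm.qExpansion_add one_pos hΓ f g]
  map_smul' a f := by
    ext i
    simp [ModularForm.qExpansion_smul one_pos hΓ a f]

lemma ModularForm.finiteDimensional_and_finrank_le [𝒢.IsArithmetic] [𝒢.HasDetOne] (hle : 𝒢 ≤ 𝒮ℒ)
    (hΓ : 1 ∈ 𝒢.strictPeriods) (k : ℤ) :
    FiniteDimensional ℂ (ModularForm 𝒢 k) ∧
      Module.finrank ℂ (ModularForm 𝒢 k) ≤ (k * 𝒢.relIndex 𝒮ℒ).toNat / 12 + 1 := by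
  set n := (k * 𝒢.relIndex 𝒮ℒ).toNat / 12
  have hinj : Function.Injective (truncatedQExpansion hΓ k (n + 1)) := by
    rw [← LinearMap.ker_eq_bot, LinearMap.ker_eq_bot']
    refine fun f hf ↦ eq_zero_of_lt_order hle hΓ f ?_
    refine lt_of_lt_of_le (Nat.cast_lt.mpr n.lt_succ_self)
      (PowerSeries.nat_le_order _ _ fun i hi ↦ ?_)
    exact congr_fun hf ⟨i, hi⟩
  exact ⟨.of_injective _ hinj, by simpa using LinearMap.finrank_le_finrank_of_injective hinj⟩

end

section

open scoped MatrixGroups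

lemma CongruenceSubgroup.Gamma0_mem_iff_dvd {N : ℕ} {A : SL(2, ℤ)} :
    A ∈ Gamma0 N ↔ (N : ℤ) ∣ A 1 0 := by
  rw [Gamma0_mem, ZMod.intCast_zmod_eq_zero_iff_dvd]

lemma CongruenceSubgroup.Gamma0_le_of_dvd {M N : ℕ} (h : M ∣ N) : Gamma0 N ≤ Gamma0 M :=
  fun _ hA ↦ Gamma0_mem_iff_dvd.mpr
    ((Int.natCast_dvd_natCast.mpr h).trans (Gamma0_mem_iff_dvd.mp hA))

/-- Two elements of `Γ₀(N)` with lower left entries `N * c` and `N * c'` are congruent modulo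
`Γ₀(N * p)` as soon as the points `[a : c]` and `[a' : c']` of `ℙ¹(𝔽_p)` agree. -/
lemma CongruenceSubgroup.inv_mul_mem_Gamma0_mul {N p : ℕ} {A B : SL(2, ℤ)} {c c' : ℤ}
    (hA : A 1 0 = N * c) (hB : B 1 0 = N * c') (h : (A 0 0 : ZMod p) * c' = B 0 0 * c) :
    A⁻¹ * B ∈ Gamma0 (N * p) := by
  have hdvd : (p : ℤ) ∣ A 0 0 * c' - B 0 0 * c := by
    rw [← ZMod.intCast_zmod_eq_zero_iff_dvd]
    push_cast
    rw [h, sub_self]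
  rw [Gamma0_mem_iff_dvd]
  obtain ⟨t, ht⟩ := hdvd
  refine ⟨t, ?_⟩
  simp only [Matrix.SpecialLinearGroup.coe_mul, Matrix.SpecialLinearGroup.coe_inv,
    Matrix.adjugate_fin_two, Matrix.mul_apply, Fin.sum_univ_two, hA, hB, Matrix.of_apply,
    Matrix.cons_val_zero, Matrix.cons_val_one]
  push_cast
  linear_combination (N : ℤ) * ht

lemma CongruenceSubgroup.exists_eq_mul_of_mem_Gamma0 {N : ℕ} (A : Gamma0 N) :
    ∃ c : ℤ, A.1 1 0 = N * c :=
  Gamma0_mem_iff_dvd.mp A.2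

lemma Subgroup.relIndex_le_card_of_map {G α : Type*} [Group G] [Finite α] {H K : Subgroup G}
    (φ : K → α) (hφ : ∀ a b : K, φ a = φ b → (a : G)⁻¹ * b ∈ H) : H.relIndex K ≤ Nat.card α := by
  refine Nat.card_le_card_of_injective (fun q : K ⧸ H.subgroupOf K ↦ φ q.out) fun q r hqr ↦ ?_
  rw [← q.out_eq', ← r.out_eq']
  exact QuotientGroup.eq.mpr (Subgroup.mem_subgroupOf.mpr (hφ _ _ hqr))

lemma CongruenceSubgroup.relIndex_Gamma0_mul_le (N p : ℕ) [Fact p.Prime] :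
    (Gamma0 (N * p)).relIndex (Gamma0 N) ≤ p + 1 := by
  classical
  choose c hc using exists_eq_mul_of_mem_Gamma0 (N := N)
  refine (Subgroup.relIndex_le_card_of_map (α := Option (ZMod p))
    (fun A : Gamma0 N ↦
      if (A.1 0 0 : ZMod p) = 0 then none else some ((c A : ZMod p) / A.1 0 0))
    fun A B hAB ↦ inv_mul_mem_Gamma0_mul (hc A) (hc B) ?_).trans_eq (by simp)
  split_ifs at hAB with h₁ h₂ h₂
  · simp [h₁, h₂]
  · rw [Option.some_inj, div_eq_div_iff h₁ h₂] at hAB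
    linear_combination -hAB

lemma CongruenceSubgroup.relIndex_Gamma0_mul_le_of_dvd {N p : ℕ} [Fact p.Prime] (hp : p ∣ N) :
    (Gamma0 (N * p)).relIndex (Gamma0 N) ≤ p := by
  choose c hc using exists_eq_mul_of_mem_Gamma0 (N := N)
  have hunit (A : Gamma0 N) : (A.1 0 0 : ZMod p) ≠ 0 := fun h₀ ↦ by
    have hdet := A.1.det_coe
    rw [Matrix.det_fin_two, hc A] at hdet
    have hN : (N : ZMod p) = 0 := (ZMod.natCast_eq_zero_iff N p).mpr hp
    simpa [h₀, hN] using congr_arg (Int.cast : ℤ → ZMod p) hdet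
  refine (Subgroup.relIndex_le_card_of_map (fun A : Gamma0 N ↦ (c A : ZMod p) / A.1 0 0)
    fun A B hAB ↦ inv_mul_mem_Gamma0_mul (hc A) (hc B) ?_).trans_eq (by simp)
  rw [div_eq_div_iff (hunit A) (hunit B)] at hAB
  linear_combination -hAB

lemma CongruenceSubgroup.index_Gamma0_le {N : ℕ} (hN : 0 < N) :
    ((Gamma0 N).index : ℝ) ≤ N * ∏ p ∈ N.primeFactors, (1 + 1 / (p : ℝ)) := by
  induction N using induction_on_primes with
  | zero => omega
  | one =>
    have : Gamma0 1 = ⊤ := eq_top_iff.mpr fun _ _ ↦ Gamma0_mem_iff_dvd.mpr (by simp)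
    simp [this]
  | prime_mul p N hp ih =>
    have : Fact p.Prime := ⟨hp⟩
    have hN₀ : 0 < N := Nat.pos_of_mul_pos_left hN
    have hp₀ : (p : ℝ) ≠ 0 := by exact_mod_cast hp.ne_zero
    have hprod : 0 ≤ ∏ q ∈ N.primeFactors, (1 + 1 / (q : ℝ)) :=
      Finset.prod_nonneg fun q _ ↦ by positivity
    rw [mul_comm p N, ← Subgroup.relIndex_mul_index (Gamma0_le_of_dvd (dvd_mul_right N p))]
    push_cast
    by_cases hpN : p ∣ N
    · have hr : ((Gamma0 (N * p)).relIndex (Gamma0 N) : ℝ) ≤ p := by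
        exact_mod_cast relIndex_Gamma0_mul_le_of_dvd hpN
      rw [Nat.primeFactors_mul hN₀.ne' hp.ne_zero, hp.primeFactors,
        Finset.union_eq_left.mpr (by simp [hp, hpN, hN₀.ne'])]
      calc _ ≤ (p : ℝ) * (N * ∏ q ∈ N.primeFactors, (1 + 1 / (q : ℝ))) := by gcongr; exact ih hN₀
        _ = _ := by ring
    · have hr : ((Gamma0 (N * p)).relIndex (Gamma0 N) : ℝ) ≤ p + 1 := by
        exact_mod_cast relIndex_Gamma0_mul_le N p
      rw [Nat.primeFactors_mul hN₀.ne' hp.ne_zero, hp.primeFactors,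
        Finset.prod_union (by simp [hpN]), Finset.prod_singleton]
      calc _ ≤ ((p : ℝ) + 1) * (N * ∏ q ∈ N.primeFactors, (1 + 1 / (q : ℝ))) := by
            gcongr; exact ih hN₀
        _ = _ := by field_simp

end

/-- The space `M_k(Γ0(N))` is finite dimensional, of dimension at most
`B(N,k) + 1` where `B(N,k) = (Nk/12)·∏_{p ∣ N} (1 + 1/p)`. -/
theorem finrank_modularForm_le
    (N : ℕ) (hN : 0 < N) (k : ℤ) (hk : 2 ≤ k) (hke : Even k) :
    FiniteDimensional ℂ (ModularForm (Gamma0 N) k) ∧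
    (Module.finrank ℂ (ModularForm (Gamma0 N) k) : ℝ) ≤
      (N * k : ℝ) / 12 * ∏ p ∈ N.primeFactors, (1 + 1 / (p : ℝ)) + 1 := by
  have : NeZero N := ⟨hN.ne'⟩
  obtain ⟨hfin, hle⟩ := ModularForm.finiteDimensional_and_finrank_le
    (𝒢 := (Gamma0 N : Subgroup (GL (Fin 2) ℝ))) (Subgroup.map_le_range _ _) (by simp) k
  refine ⟨hfin, ?_⟩
  lift k to ℕ using by omega
  rw [MonoidHom.range_eq_map, Subgroup.relIndex_map_map_of_injective _ _
    Matrix.SpecialLinearGroup.mapGL_injective, Subgroup.relIndex_top_right, ← Nat.cast_mul,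
    Int.toNat_natCast] at hle
  calc (Module.finrank ℂ (ModularForm (Gamma0 N) k) : ℝ)
      ≤ ((k * (Gamma0 N).index / 12 : ℕ) : ℝ) + 1 := by exact_mod_cast hle
    _ ≤ (k * (Gamma0 N).index : ℝ) / 12 + 1 := by
        gcongr
        exact_mod_cast Nat.cast_div_le (α := ℝ)
    _ ≤ k * (N * ∏ p ∈ N.primeFactors, (1 + 1 / (p : ℝ))) / 12 + 1 := by
        gcongr
        exact index_Gamma0_le hN
    _ = _ := by push_cast; ring
end

section
/- For every positive integer N and every even integer k ≥ 2, every f ∈ M_k(Γ0(N)) is a ℂ-linear combination of products g_1·g_2⋯g_r, where each g_j is a holomorphic modular form on Γ0(N) of weight k_j ∈ {2, 4, 6} and k_1 + k_2 + … + k_r = k. That is, the graded ring ⊕_{k even} M_k(Γ0(N)) is generated as a ℂ-algebra by forms of weight at most 6. -/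
open CongruenceSubgroup

namespace LowWeight

open UpperHalfPlane ModularForm Filter Topology Manifold MatrixGroups Asymptotics

noncomputable section

/-- Holomorphic modular forms of weight `k` for `Γ ≤ SL(2, ℤ)`, as a space of functions. -/
def MF (Γ : Subgroup SL(2, ℤ)) (k : ℤ) : Submodule ℂ (ℍ → ℂ) where
  carrier := {f | MDiff f ∧ (∀ γ ∈ Γ, f ∣[k] γ = f) ∧
    ∀ γ : SL(2, ℤ), IsBoundedAtImInfty (f ∣[k] γ)}
  add_mem' {f g} hf hg := by
    refine ⟨hf.1.add hg.1, fun γ hγ ↦ ?_, fun γ ↦ ?_⟩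
    · rw [SlashAction.add_slash, hf.2.1 γ hγ, hg.2.1 γ hγ]
    · rw [SlashAction.add_slash]
      exact (hf.2.2 γ).add (hg.2.2 γ)
  zero_mem' := by
    refine ⟨mdifferentiable_const, fun γ _ ↦ SlashAction.zero_slash _ _, fun γ ↦ ?_⟩
    rw [SlashAction.zero_slash]
    exact (zero_form_isBoundedAtImInfty)
  smul_mem' c f hf := by
    refine ⟨hf.1.const_smul c, fun γ hγ ↦ ?_, fun γ ↦ ?_⟩
    · rw [ModularForm.SL_smul_slash, hf.2.1 γ hγ]
    · rw [ModularForm.SL_smul_slash]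
      exact (hf.2.2 γ).const_smul_left c

/-- Cusp forms of weight `k` for `Γ ≤ SL(2, ℤ)`, as a space of functions. -/
def CF (Γ : Subgroup SL(2, ℤ)) (k : ℤ) : Submodule ℂ (ℍ → ℂ) where
  carrier := {f | MDiff f ∧ (∀ γ ∈ Γ, f ∣[k] γ = f) ∧
    ∀ γ : SL(2, ℤ), IsZeroAtImInfty (f ∣[k] γ)}
  add_mem' {f g} hf hg := by
    refine ⟨hf.1.add hg.1, fun γ hγ ↦ ?_, fun γ ↦ ?_⟩
    · rw [SlashAction.add_slash, hf.2.1 γ hγ, hg.2.1 γ hγ]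
    · rw [SlashAction.add_slash]
      exact (hf.2.2 γ).add (hg.2.2 γ)
  zero_mem' := by
    refine ⟨mdifferentiable_const, fun γ _ ↦ SlashAction.zero_slash _ _, fun γ ↦ ?_⟩
    rw [SlashAction.zero_slash]
    exact tendsto_const_nhds
  smul_mem' c f hf := by
    refine ⟨hf.1.const_smul c, fun γ hγ ↦ ?_, fun γ ↦ ?_⟩
    · rw [ModularForm.SL_smul_slash, hf.2.1 γ hγ]
    · rw [ModularForm.SL_smul_slash]
      exact (hf.2.2 γ).smul c

variable {Γ : Subgroup SL(2, ℤ)} {k l p w : ℤ} {f g P : ℍ → ℂ}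

section

lemma MF.mdiff (hf : f ∈ MF Γ k) : MDiff f := hf.1
lemma MF.bdd_self (hf : f ∈ MF Γ k) : IsBoundedAtImInfty f := by
  simpa using hf.2.2 1

lemma CF_le_MF : CF Γ k ≤ MF Γ k := fun _ hf ↦
  ⟨hf.1, hf.2.1, fun γ ↦ (hf.2.2 γ).isBoundedAtImInfty⟩

lemma MF_mono {Γ' : Subgroup SL(2, ℤ)} (h : Γ' ≤ Γ) : MF Γ k ≤ MF Γ' k := fun _ hf ↦
  ⟨hf.1, fun γ hγ ↦ hf.2.1 γ (h hγ), hf.2.2⟩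

lemma MF.mul (hf : f ∈ MF Γ k) (hg : g ∈ MF Γ l) : f * g ∈ MF Γ (k + l) := by
  refine ⟨hf.1.mul hg.1, fun γ hγ ↦ ?_, fun γ ↦ ?_⟩
  · rw [ModularForm.mul_slash_SL2, hf.2.1 γ hγ, hg.2.1 γ hγ]
  · rw [ModularForm.mul_slash_SL2]
    exact (hf.2.2 γ).mul (hg.2.2 γ)

lemma CF.mul (hf : f ∈ CF Γ k) (hg : g ∈ MF Γ l) : f * g ∈ CF Γ (k + l) := by
  refine ⟨hf.1.mul hg.1, fun γ hγ ↦ ?_, fun γ ↦ ?_⟩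
  · rw [ModularForm.mul_slash_SL2, hf.2.1 γ hγ, hg.2.1 γ hγ]
  · rw [ModularForm.mul_slash_SL2]
    exact ZeroAtFilter.mul_boundedAtFilter (hf.2.2 γ) (hg.2.2 γ)

lemma MF_one : (1 : ℍ → ℂ) ∈ MF Γ 0 := by
  refine ⟨mdifferentiable_const, fun γ _ ↦ ModularForm.is_invariant_one γ, fun γ ↦ ?_⟩
  rw [ModularForm.is_invariant_one γ]
  exact const_boundedAtFilter _ _

lemma MF.pow (hf : f ∈ MF Γ k) (n : ℕ) : f ^ n ∈ MF Γ (n * k) := by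
  induction n with
  | zero => simpa using MF_one
  | succ n ih =>
    rw [pow_succ]; push_cast; rw [add_mul, one_mul]; exact MF.mul ih hf

lemma eq_zero_or_eq_zero (hf : MDiff f) (hg : MDiff g) (h : f * g = 0) : f = 0 ∨ g = 0 :=
  (UpperHalfPlane.mul_eq_zero_iff hf hg).1 h

lemma mem_MF (f : ModularForm (Γ : Subgroup (GL (Fin 2) ℝ)) k) [Γ.FiniteIndex] :
    (f : ℍ → ℂ) ∈ MF Γ k := by
  refine ⟨f.holo', fun γ hγ ↦ ?_, fun γ ↦ ?_⟩
  · exact SlashInvariantForm.slash_action_eqn f _ (Subgroup.mem_map_of_mem _ hγ)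
  · exact ModularFormClass.bdd_at_infty_slash f γ

/-- An element of `MF Γ k`, bundled as a `ModularForm`. -/
def MF.toModularForm [Γ.FiniteIndex] (hf : f ∈ MF Γ k) :
    ModularForm (Γ : Subgroup (GL (Fin 2) ℝ)) k where
  toFun := f
  slash_action_eq' γ hγ := by
    obtain ⟨γ, hγ, rfl⟩ := hγ
    exact hf.2.1 γ hγ
  holo' := hf.1
  bdd_at_cusps' {c} hc := by
    rw [Subgroup.IsArithmetic.isCusp_iff_isCusp_SL2Z] at hc
    rw [OnePoint.isBoundedAt_iff_forall_SL2Z hc]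
    exact fun γ _ ↦ hf.2.2 γ

lemma MF_neg [Γ.FiniteIndex] (hf : f ∈ MF Γ k) (hk : k < 0) : f = 0 := by
  have := ModularForm.isZero_of_neg_weight hk (MF.toModularForm hf)
  exact congrArg (fun g : ModularForm _ k ↦ (g : ℍ → ℂ)) this

lemma MF_zero [Γ.FiniteIndex] (hf : f ∈ MF Γ 0) : ∃ c : ℂ, f = fun _ ↦ c := by
  obtain ⟨c, hc⟩ := ModularForm.eq_const_of_weight_zero (MF.toModularForm hf)
  refine ⟨c, ?_⟩
  exact hc

lemma CF_nonpos [Γ.FiniteIndex] (hf : f ∈ CF Γ k) (hk : k ≤ 0) : f = 0 := by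
  rcases hk.lt_or_eq with h | rfl
  · exact MF_neg (CF_le_MF hf) h
  · obtain ⟨c, rfl⟩ := MF_zero (CF_le_MF hf)
    have := hf.2.2 1
    rw [SlashAction.slash_one] at this
    have := tendsto_nhds_unique this tendsto_const_nhds
    ext; exact this.symm

end

section

lemma ne_zero_of_tendsto {c : ℂ} (hc : c ≠ 0) (h : Tendsto P atImInfty (𝓝 c)) : P ≠ 0 := by
  rintro rfl
  exact hc (tendsto_nhds_unique h tendsto_const_nhds)

lemma isBounded_of_mul {c : ℂ} (hc : c ≠ 0) (h : Tendsto P atImInfty (𝓝 c))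
    (hb : IsBoundedAtImInfty (P * f)) : IsBoundedAtImInfty f := by
  have h1 : IsBoundedAtImInfty P⁻¹ := (h.inv₀ hc).isBigO_one ℝ
  refine (h1.mul hb).congr' ?_ (by simp)
  filter_upwards [h.eventually_ne hc] with z hz
  simp [hz]

lemma isZero_of_mul {c : ℂ} (hc : c ≠ 0) (h : Tendsto P atImInfty (𝓝 c))
    (hb : IsZeroAtImInfty (P * f)) : IsZeroAtImInfty f := by
  have h1 := (h.inv₀ hc).mul hb
  rw [mul_zero] at h1
  refine h1.congr' ?_
  filter_upwards [h.eventually_ne hc] with z hz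
  simp [hz]

lemma slash_eq_of_mul_slash {γ : SL(2, ℤ)} (hP : P ≠ 0) (hPd : MDiff P) (hPs : P ∣[p] γ = P)
    (hg : MDiff g) (h : (P * g) ∣[p + k] γ = P * g) : g ∣[k] γ = g := by
  rw [ModularForm.mul_slash_SL2, hPs] at h
  have hd : MDiff (g ∣[k] γ) := hg.slash k _
  have : P * (g ∣[k] γ - g) = 0 := by rw [mul_sub, h, sub_self]
  rcases eq_zero_or_eq_zero hPd (hd.sub hg) this with h | h
  · exact absurd h hP
  · exact sub_eq_zero.1 h

lemma MF.of_mul {c : ℂ} (hP : P ∈ MF ⊤ p) (hc : c ≠ 0) (hl : Tendsto P atImInfty (𝓝 c))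
    (hg : MDiff g) (h : P * g ∈ MF Γ (p + k)) : g ∈ MF Γ k := by
  refine ⟨hg, fun γ hγ ↦ ?_, fun γ ↦ ?_⟩
  · exact slash_eq_of_mul_slash (ne_zero_of_tendsto hc hl) hP.1 (hP.2.1 γ trivial) hg (h.2.1 γ hγ)
  · have := h.2.2 γ
    rw [ModularForm.mul_slash_SL2, hP.2.1 γ trivial] at this
    exact isBounded_of_mul hc hl this

lemma CF.of_mul {c : ℂ} (hP : P ∈ MF ⊤ p) (hc : c ≠ 0) (hl : Tendsto P atImInfty (𝓝 c))
    (hg : MDiff g) (h : P * g ∈ CF Γ (p + k)) : g ∈ CF Γ k := by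
  refine ⟨hg, fun γ hγ ↦ ?_, fun γ ↦ ?_⟩
  · exact slash_eq_of_mul_slash (ne_zero_of_tendsto hc hl) hP.1 (hP.2.1 γ trivial) hg (h.2.1 γ hγ)
  · have := h.2.2 γ
    rw [ModularForm.mul_slash_SL2, hP.2.1 γ trivial] at this
    exact isZero_of_mul hc hl this

/-- Level one forms that do not vanish at the cusp and have only simple zeros. -/
structure IsSimple (P : ℍ → ℂ) (p : ℤ) : Prop where
  mem : P ∈ MF ⊤ p
  lim : ∃ c : ℂ, c ≠ 0 ∧ Tendsto P atImInfty (𝓝 c)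
  simple : ∀ z : ℍ, P z = 0 → deriv (P ∘ ofComplex) z ≠ 0

lemma exists_mdiff_quotient {G : ℍ → ℂ} (hP : MDiff P) (hG : MDiff G)
    (hs : ∀ z : ℍ, P z = 0 → deriv (P ∘ ofComplex) z ≠ 0)
    (h0 : ∀ z, P z = 0 → G z = 0) : ∃ g : ℍ → ℂ, MDiff g ∧ G = P * g := by
  set g : ℍ → ℂ := fun z ↦ if P z = 0 then
    deriv (G ∘ ofComplex) z / deriv (P ∘ ofComplex) z else G z / P z with hg
  have hPd := UpperHalfPlane.mdifferentiable_iff.1 hP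
  have hGd := UpperHalfPlane.mdifferentiable_iff.1 hG
  refine ⟨g, fun z₀ ↦ ?_, ?_⟩
  · rw [UpperHalfPlane.mdifferentiableAt_iff]
    have hU : upperHalfPlaneSet ∈ 𝓝 (z₀ : ℂ) :=
      isOpen_upperHalfPlaneSet.mem_nhds z₀.im_pos
    by_cases hz : P z₀ = 0
    · have hDP := (Complex.differentiableOn_dslope hU).2 hPd
      have hDG := (Complex.differentiableOn_dslope hU).2 hGd
      have hne : dslope (P ∘ ofComplex) z₀ z₀ ≠ 0 := by
        rw [dslope_same]; exact hs z₀ hz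
      have hDP' := (hDP.differentiableAt hU)
      have hDG' := (hDG.differentiableAt hU)
      refine (hDG'.div hDP' hne).congr_of_eventuallyEq ?_
      filter_upwards [hU, hDP'.continuousAt.eventually_ne hne] with z hzU hzne
      by_cases hzz : z = z₀
      · subst hzz
        simp [hg, hz, dslope_same]
      · have e1 : P (ofComplex z) = (z - z₀) * dslope (P ∘ ofComplex) z₀ z := by
          have := sub_smul_dslope (P ∘ ofComplex) z₀ z
          simp [hz] at this
          simpa using this.symm
        have e2 : G (ofComplex z) = (z - z₀) * dslope (G ∘ ofComplex) z₀ z := by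
          have := sub_smul_dslope (G ∘ ofComplex) z₀ z
          simp [h0 _ hz] at this
          simpa using this.symm
        have hzz' : z - z₀ ≠ 0 := sub_ne_zero.2 hzz
        have : P (ofComplex z) ≠ 0 := by rw [e1]; exact mul_ne_zero hzz' hzne
        simp only [hg, Function.comp_apply, if_neg this, Pi.div_apply]
        rw [e1, e2, mul_div_mul_left _ _ hzz']
    · have hPz := (hPd.differentiableAt hU)
      have hGz := (hGd.differentiableAt hU)
      have hne : (P ∘ ofComplex) z₀ ≠ 0 := by simpa using hz
      refine (hGz.div hPz hne).congr_of_eventuallyEq ?_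
      filter_upwards [hPz.continuousAt.eventually_ne hne] with z hzne
      simp only [Function.comp_apply] at hzne
      simp [hg, hzne]
  · ext z
    by_cases hz : P z = 0
    · simp [hz, h0 z hz]
    · simp [hg, hz, mul_div_cancel₀]

lemma IsSimple.exists_eq_mul (hP : IsSimple P p) {G : ℍ → ℂ} (hG : G ∈ MF Γ k)
    (h0 : ∀ z, P z = 0 → G z = 0) : ∃ g ∈ MF Γ (k - p), G = P * g := by
  obtain ⟨g, hg, rfl⟩ := exists_mdiff_quotient hP.mem.1 hG.1 hP.simple h0
  obtain ⟨c, hc, hl⟩ := hP.lim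
  exact ⟨g, MF.of_mul hP.mem hc hl hg (by rwa [add_sub_cancel]), rfl⟩

lemma IsSimple.ne_zero (hP : IsSimple P p) : P ≠ 0 := by
  obtain ⟨c, hc, hl⟩ := hP.lim
  exact ne_zero_of_tendsto hc hl

lemma IsSimple.cusp (hP : IsSimple P p) (hg : g ∈ MF Γ k) (h : P * g ∈ CF Γ (p + k)) :
    g ∈ CF Γ k := by
  obtain ⟨c, hc, hl⟩ := hP.lim
  exact CF.of_mul hP.mem hc hl hg.1 h

lemma mul_left_cancel_mdiff (hP : P ≠ 0) (hPd : MDiff P) (hf : MDiff f) (hg : MDiff g)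
    (h : P * f = P * g) : f = g := by
  have : P * (f - g) = 0 := by rw [mul_sub, h, sub_self]
  exact sub_eq_zero.1 ((eq_zero_or_eq_zero hPd (hf.sub hg) this).resolve_left hP)

/-! ### Components and trace -/

/-- The components `f ∣ γ⁻¹` of a form, indexed by cosets. -/
def comp (k : ℤ) (f : ℍ → ℂ) (q : SL(2, ℤ) ⧸ Γ) : ℍ → ℂ := f ∣[k] (q.out)⁻¹

lemma comp_mk (hf : ∀ γ ∈ Γ, f ∣[k] γ = f) (a : SL(2, ℤ)) :
    comp k f (a : SL(2, ℤ) ⧸ Γ) = f ∣[k] a⁻¹ := by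
  obtain ⟨h, hh⟩ := QuotientGroup.mk_out_eq_mul Γ a
  rw [comp, hh, mul_inv_rev, SlashAction.slash_mul, hf _ (inv_mem h.2)]

lemma comp_slash (hf : ∀ γ ∈ Γ, f ∣[k] γ = f) (q : SL(2, ℤ) ⧸ Γ) (γ : SL(2, ℤ)) :
    comp k f q ∣[k] γ = comp k f (γ⁻¹ • q) := by
  induction q using QuotientGroup.induction_on with
  | H a =>
    rw [comp_mk hf, MulAction.Quotient.smul_coe, comp_mk hf, ← SlashAction.slash_mul]
    simp

lemma comp_mul (q : SL(2, ℤ) ⧸ Γ) :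
    comp (k + l) (f * g) q = comp k f q * comp l g q := by
  rw [comp, ModularForm.mul_slash_SL2]; rfl

lemma comp_add (q : SL(2, ℤ) ⧸ Γ) : comp k (f + g) q = comp k f q + comp k g q :=
  SlashAction.add_slash ..

lemma comp_smul (c : ℂ) (q : SL(2, ℤ) ⧸ Γ) : comp k (c • f) q = c • comp k f q :=
  ModularForm.SL_smul_slash ..

lemma comp_level_one (hf : f ∈ MF ⊤ k) (q : SL(2, ℤ) ⧸ Γ) : comp k f q = f :=
  hf.2.1 _ trivial

lemma comp_pow (n : ℕ) (q : SL(2, ℤ) ⧸ Γ) : comp (n * k) (f ^ n) q = comp k f q ^ n := by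
  induction n with
  | zero => simp [comp, ModularForm.is_invariant_one]
  | succ n ih => rw [pow_succ]; push_cast; rw [add_mul, one_mul, comp_mul, ih, pow_succ]

lemma comp_one_coset (hf : ∀ γ ∈ Γ, f ∣[k] γ = f) :
    comp k f ((1 : SL(2, ℤ)) : SL(2, ℤ) ⧸ Γ) = f := by
  rw [comp_mk hf]; simp

lemma comp_mdiff (hf : MDiff f) (q : SL(2, ℤ) ⧸ Γ) : MDiff (comp k f q) := hf.slash k _

variable [Γ.FiniteIndex]

instance : Fintype (SL(2, ℤ) ⧸ Γ) := Fintype.ofFinite _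

variable (Γ) in
/-- The trace to level one. -/
def tr (k : ℤ) : (ℍ → ℂ) →ₗ[ℂ] (ℍ → ℂ) where
  toFun f := ∑ q : SL(2, ℤ) ⧸ Γ, comp k f q
  map_add' f g := by simp [comp_add, Finset.sum_add_distrib]
  map_smul' c f := by simp [comp_smul, Finset.smul_sum]

lemma tr_def (f : ℍ → ℂ) : tr Γ k f = ∑ q : SL(2, ℤ) ⧸ Γ, comp k f q := rfl

lemma tr_slash (hf : ∀ γ ∈ Γ, f ∣[k] γ = f) (γ : SL(2, ℤ)) : tr Γ k f ∣[k] γ = tr Γ k f := by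
  rw [tr_def, SlashAction.sum_slash]
  simp_rw [comp_slash hf]
  exact Equiv.sum_comp (MulAction.toPerm γ⁻¹) _

lemma tr_mem (hf : f ∈ MF Γ k) : tr Γ k f ∈ MF ⊤ k := by
  have h : IsBoundedAtImInfty (tr Γ k f) := by
    rw [tr_def]
    have := Submodule.sum_mem (boundedAtImInftySubalgebra ℂ).toSubmodule
      (t := Finset.univ) (f := fun q : SL(2, ℤ) ⧸ Γ ↦ comp k f q) (fun q _ ↦ hf.2.2 _)
    exact this
  refine ⟨?_, fun γ _ ↦ tr_slash hf.2.1 γ, fun γ ↦ ?_⟩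
  · exact MDifferentiable.sum fun q _ ↦ comp_mdiff hf.1 q
  · rwa [tr_slash hf.2.1]

lemma tr_mem_cusp (hf : f ∈ CF Γ k) : tr Γ k f ∈ CF ⊤ k := by
  have h : IsZeroAtImInfty (tr Γ k f) := by
    rw [tr_def]
    exact Submodule.sum_mem (zeroAtImInftySubmodule ℂ)
      (t := Finset.univ) (f := fun q : SL(2, ℤ) ⧸ Γ ↦ comp k f q) (fun q _ ↦ hf.2.2 _)
  refine ⟨(tr_mem (CF_le_MF hf)).1, fun γ _ ↦ tr_slash hf.2.1 γ, fun γ ↦ ?_⟩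
  rwa [tr_slash hf.2.1]

lemma tr_mul_level_one (hf : f ∈ MF ⊤ k) : tr Γ (k + l) (f * g) = f * tr Γ l g := by
  simp_rw [tr_def, Finset.mul_sum, comp_mul, comp_level_one hf]

/-! ### Power sums -/

lemma eq_zero_of_power_sums {ι : Type*} [Fintype ι] (L : ι → ℂ)
    (h : ∀ n : ℕ, ∑ i, L i ^ (n + 1) = 0) (i : ι) : L i = 0 := by
  classical
  by_contra hi
  have key : ∀ p : Polynomial ℂ, ∑ j, L j * p.eval (L j) = 0 := by
    intro p
    simp_rw [Polynomial.eval_eq_sum_range, Finset.mul_sum]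
    rw [Finset.sum_comm]
    refine Finset.sum_eq_zero fun n _ ↦ ?_
    have := h n
    calc _ = p.coeff n * ∑ j, L j ^ (n + 1) := by
          rw [Finset.mul_sum]; exact Finset.sum_congr rfl fun j _ ↦ by ring
      _ = 0 := by rw [this, mul_zero]
  set S := (Finset.univ.image L).erase (L i) with hS
  have h1 := key (∏ w ∈ S, (Polynomial.X - Polynomial.C w))
  simp_rw [Polynomial.eval_prod, Polynomial.eval_sub, Polynomial.eval_X, Polynomial.eval_C] at h1
  have h2 : ∀ j, L j * ∏ w ∈ S, (L j - w) =
      if L j = L i then L i * ∏ w ∈ S, (L i - w) else 0 := by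
    intro j
    split_ifs with hj
    · rw [hj]
    · rw [Finset.prod_eq_zero (i := L j) (by simp [hS, hj]) (sub_self _), mul_zero]
  rw [Finset.sum_congr rfl fun j _ ↦ h2 j] at h1
  rw [← Finset.sum_filter, Finset.sum_const, nsmul_eq_mul, mul_eq_zero] at h1
  rcases h1 with h1 | h1
  · rw [Nat.cast_eq_zero, Finset.card_eq_zero] at h1
    have : i ∈ Finset.univ.filter (fun j ↦ L j = L i) := by simp
    simp [h1] at this
  · rcases mul_eq_zero.1 h1 with h1 | h1
    · exact hi h1
    · rw [Finset.prod_eq_zero_iff] at h1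
      obtain ⟨w, hw, hw'⟩ := h1
      rw [sub_eq_zero] at hw'
      subst hw'
      simp [hS] at hw

lemma MF.eq_zero_of_traces (hf : f ∈ MF Γ k)
    (h : ∀ n : ℕ, tr Γ ((n + 1 : ℕ) * k) (f ^ (n + 1)) = 0) : f = 0 := by
  rw [← comp_one_coset hf.2.1]
  ext z
  refine eq_zero_of_power_sums (fun q : SL(2, ℤ) ⧸ Γ ↦ comp k f q z) (fun n ↦ ?_) _
  have := congrFun (h n) z
  rw [tr_def] at this
  simp_rw [comp_pow] at this
  simpa using this

end

section

lemma mem_MF_top (f : ModularForm 𝒮ℒ k) : (f : ℍ → ℂ) ∈ MF ⊤ k := by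
  refine ⟨f.holo', fun γ _ ↦ ?_, fun γ ↦ ModularFormClass.bdd_at_infty_slash f γ⟩
  exact SlashInvariantForm.slash_action_eqn f _ ⟨γ, rfl⟩

lemma mem_CF_top (f : CuspForm 𝒮ℒ k) : (f : ℍ → ℂ) ∈ CF ⊤ k := by
  refine ⟨f.holo', fun γ _ ↦ ?_, fun γ ↦ CuspFormClass.zero_at_infty_slash f γ⟩
  exact SlashInvariantForm.slash_action_eqn f _ ⟨γ, rfl⟩

lemma exists_modularForm (hf : f ∈ MF ⊤ k) : ∃ F : ModularForm 𝒮ℒ k, ⇑F = f :=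
  ⟨{ toFun := f
     slash_action_eq' := by rintro _ ⟨γ, rfl⟩; exact hf.2.1 γ trivial
     holo' := hf.1
     bdd_at_cusps' := fun {c} hc ↦ by
      rw [Subgroup.IsArithmetic.isCusp_iff_isCusp_SL2Z] at hc
      rw [OnePoint.isBoundedAt_iff_forall_SL2Z hc]
      exact fun γ _ ↦ hf.2.2 γ }, rfl⟩

lemma exists_cuspForm (hf : f ∈ CF ⊤ k) : ∃ F : CuspForm 𝒮ℒ k, ⇑F = f :=
  ⟨{ toFun := f
     slash_action_eq' := by rintro _ ⟨γ, rfl⟩; exact hf.2.1 γ trivial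
     holo' := hf.1
     zero_at_cusps' := fun {c} hc ↦ by
      rw [Subgroup.IsArithmetic.isCusp_iff_isCusp_SL2Z] at hc
      rw [OnePoint.isZeroAt_iff_forall_SL2Z hc]
      exact fun γ _ ↦ hf.2.2 γ }, rfl⟩

/-- The level one Eisenstein series of weight 4, as a function. -/
def e4 : ℍ → ℂ := E₄
/-- The level one Eisenstein series of weight 6, as a function. -/
def e6 : ℍ → ℂ := E₆
/-- The discriminant, as a function. -/
def dl : ℍ → ℂ := discriminant

lemma e4_mem : e4 ∈ MF ⊤ 4 := mem_MF_top _
lemma e6_mem : e6 ∈ MF ⊤ 6 := mem_MF_top _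
lemma dl_mem : dl ∈ CF ⊤ 12 := mem_CF_top CuspForm.discriminant
lemma dl_ne (z : ℍ) : dl z ≠ 0 := discriminant_ne_zero z
lemma dl_ne_zero : dl ≠ 0 := fun h ↦ dl_ne I (congrFun h _)
lemma dl_eq : dl = (1728⁻¹ : ℂ) • (e4 ^ 3 - e6 ^ 2) := by
  ext z
  have := discriminant_eq_E₄_cube_sub_E₆_sq z
  simp only [dl, e4, e6, this, Pi.smul_apply, Pi.sub_apply, Pi.pow_apply, smul_eq_mul]
  ring

lemma e4_mem' : e4 ∈ MF Γ 4 := MF_mono le_top e4_mem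
lemma e6_mem' : e6 ∈ MF Γ 6 := MF_mono le_top e6_mem

open Derivative in
lemma tendsto_deriv_div (F : ModularForm 𝒮ℒ k) :
    Tendsto F atImInfty (𝓝 ((qExpansion 1 F).coeff 0)) ∧
    Tendsto (fun z : ℍ ↦ normalizedDerivOfComplex F z / Function.Periodic.qParam 1 z) atImInfty
      (𝓝 ((qExpansion 1 F).coeff 1)) := by
  have hq : Tendsto (fun z : ℍ ↦ Function.Periodic.qParam 1 z) atImInfty (𝓝 0) :=
    qParam_tendsto_atImInfty one_pos
  have han : AnalyticAt ℂ (cuspFunction 1 F) 0 :=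
    ModularFormClass.analyticAt_cuspFunction_zero F one_pos one_mem_strictPeriods_SL
  have heq (z : ℍ) : cuspFunction 1 F (Function.Periodic.qParam 1 z) = F z :=
    SlashInvariantFormClass.eq_cuspFunction F z one_mem_strictPeriods_SL one_ne_zero
  constructor
  · have h0 : (qExpansion 1 F).coeff 0 = cuspFunction 1 F 0 := by simp [qExpansion_coeff]
    rw [h0]
    exact (han.continuousAt.tendsto.comp hq).congr heq
  · have h1 : (qExpansion 1 F).coeff 1 = deriv (cuspFunction 1 F) 0 := by simp [qExpansion_coeff]
    rw [h1]
    refine (han.deriv.continuousAt.tendsto.comp hq).congr fun z ↦ ?_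
    have hz : deriv (F ∘ ofComplex) z = deriv (cuspFunction 1 F) (Function.Periodic.qParam 1 z) *
        (2 * Real.pi * Complex.I * Function.Periodic.qParam 1 z) := by
      have hd : DifferentiableAt ℂ (cuspFunction 1 F) (Function.Periodic.qParam 1 z) :=
        ModularFormClass.differentiableAt_cuspFunction F one_pos one_mem_strictPeriods_SL
          (Function.Periodic.norm_qParam_lt_one one_pos z.im_pos)
      have hqd : HasDerivAt (Function.Periodic.qParam 1)
          (2 * Real.pi * Complex.I * Function.Periodic.qParam 1 z) (z : ℂ) := by
        have h2 : HasDerivAt (fun x : ℂ ↦ Complex.exp (2 * Real.pi * Complex.I * x / (1 : ℝ)))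
            _ (z : ℂ) := (((hasDerivAt_id (z : ℂ)).const_mul _).div_const _).cexp
        refine h2.congr_deriv ?_
        simp [Function.Periodic.qParam, mul_comm]
      rw [← (hd.hasDerivAt.comp _ hqd).deriv]
      refine Filter.EventuallyEq.deriv_eq ?_
      filter_upwards [isOpen_upperHalfPlaneSet.mem_nhds z.im_pos] with x hx
      have := heq ⟨x, hx⟩
      simp only [Function.comp_apply, ofComplex_apply_of_im_pos hx]
      exact this.symm
    have hq0 : Function.Periodic.qParam 1 z ≠ 0 := Complex.exp_ne_zero _
    have hpi : (2 * Real.pi * Complex.I : ℂ) ≠ 0 := Complex.two_pi_I_ne_zero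
    simp only [Function.comp_apply, normalizedDerivOfComplex, hz]
    field_simp

lemma coeff_zero_e4 : (qExpansion 1 E₄).coeff 0 = 1 :=
  EisensteinSeries.E_qExpansion_coeff_zero _ (by decide)
lemma coeff_zero_e6 : (qExpansion 1 E₆).coeff 0 = 1 :=
  EisensteinSeries.E_qExpansion_coeff_zero _ (by decide)

lemma e4_lim : Tendsto e4 atImInfty (𝓝 1) := by
  have := (tendsto_deriv_div E₄).1
  rwa [coeff_zero_e4] at this

lemma e6_lim : Tendsto e6 atImInfty (𝓝 1) := by
  have := (tendsto_deriv_div E₆).1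
  rwa [coeff_zero_e6] at this

open Derivative in
lemma exists_wronskian : ∃ c : ℂ, c ≠ 0 ∧ ∀ z : ℍ,
    2 * e4 z * deriv (e6 ∘ ofComplex) z - 3 * e6 z * deriv (e4 ∘ ofComplex) z = c * dl z := by
  set W : ℍ → ℂ := (2 : ℂ) • (e4 * serreDerivative 6 e6) - (3 : ℂ) • (e6 * serreDerivative 4 e4)
    with hW
  have hWz (z : ℍ) : W z = 2 * e4 z * normalizedDerivOfComplex e6 z -
      3 * e6 z * normalizedDerivOfComplex e4 z := by
    simp only [hW, Pi.sub_apply, Pi.smul_apply, Pi.mul_apply, serreDerivative_apply, smul_eq_mul]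
    ring
  have hs (γ : SL(2, ℤ)) : W ∣[(12 : ℤ)] γ = W := by
    have h6 : serreDerivative 6 e6 ∣[(8 : ℤ)] γ = serreDerivative 6 e6 := by
      have := serreDerivative_slash_invariant e6_mem.1 (e6_mem.2.1 γ trivial)
      exact_mod_cast this
    have h4 : serreDerivative 4 e4 ∣[(6 : ℤ)] γ = serreDerivative 4 e4 := by
      have := serreDerivative_slash_invariant e4_mem.1 (e4_mem.2.1 γ trivial)
      exact_mod_cast this
    rw [hW, sub_eq_add_neg, SlashAction.add_slash, SlashAction.neg_slash,
      ModularForm.SL_smul_slash, ModularForm.SL_smul_slash,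
      show (12 : ℤ) = 4 + 8 by norm_num, ModularForm.mul_slash_SL2, h6, e4_mem.2.1 γ trivial,
      show (4 + 8 : ℤ) = 6 + 6 by norm_num, ModularForm.mul_slash_SL2, h4, e6_mem.2.1 γ trivial]
  have hd : MDiff W := by
    refine MDifferentiable.sub ?_ ?_
    · exact (e4_mem.1.mul (serreDerivative_mdifferentiable _ e6_mem.1)).const_smul _
    · exact (e6_mem.1.mul (serreDerivative_mdifferentiable _ e4_mem.1)).const_smul _
  have hq : Tendsto (fun z : ℍ ↦ Function.Periodic.qParam 1 z) atImInfty (𝓝 0) :=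
    qParam_tendsto_atImInfty one_pos
  have hlim : Tendsto (fun z : ℍ ↦ W z / Function.Periodic.qParam 1 z) atImInfty
      (𝓝 (-1728)) := by
    have h4 := (tendsto_deriv_div E₄).2
    have h6 := (tendsto_deriv_div E₆).2
    rw [E₄_qExpansion_coeff_one] at h4
    rw [E₆_qExpansion_coeff_one] at h6
    have := ((e4_lim.const_mul 2).mul h6).sub ((e6_lim.const_mul 3).mul h4)
    norm_num at this
    refine this.congr fun z ↦ ?_
    rw [hWz]
    simp only [e4, e6]
    ring
  have h0 : IsZeroAtImInfty W := by
    have := hlim.mul hq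
    rw [mul_zero] at this
    refine this.congr fun z ↦ div_mul_cancel₀ _ (Complex.exp_ne_zero _)
  have hWc : W ∈ CF ⊤ 12 := ⟨hd, fun γ _ ↦ hs γ, fun γ ↦ by rwa [hs]⟩
  obtain ⟨F, hF⟩ := exists_cuspForm hWc
  obtain ⟨c, hc⟩ := CuspForm.exists_smul_discriminant_of_weight_eq_twelve F
  have hcW (z : ℍ) : W z = c * dl z := by
    rw [← hF, ← hc]; rfl
  refine ⟨2 * Real.pi * Complex.I * c, mul_ne_zero Complex.two_pi_I_ne_zero ?_, fun z ↦ ?_⟩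
  · rintro rfl
    simp_rw [hcW, zero_mul, zero_div] at hlim
    exact absurd (tendsto_nhds_unique hlim tendsto_const_nhds) (by norm_num)
  · have hpi : (2 * Real.pi * Complex.I : ℂ) ≠ 0 := Complex.two_pi_I_ne_zero
    rw [mul_assoc _ c (dl z), ← hcW, hWz]
    simp only [normalizedDerivOfComplex]
    rw [mul_sub]
    congr 1 <;> field_simp

lemma e4_or_e6_ne (z : ℍ) : e4 z ≠ 0 ∨ e6 z ≠ 0 := by
  by_contra! h
  refine dl_ne z ?_
  rw [dl_eq]
  simp [h.1, h.2]

lemma e4_simple : IsSimple e4 4 := by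
  refine ⟨e4_mem, ⟨1, one_ne_zero, e4_lim⟩, fun z hz hd ↦ ?_⟩
  obtain ⟨c, hc, h⟩ := exists_wronskian
  have := h z
  rw [hz, hd] at this
  simp at this
  exact this.elim hc (dl_ne z)

lemma e6_simple : IsSimple e6 6 := by
  refine ⟨e6_mem, ⟨1, one_ne_zero, e6_lim⟩, fun z hz hd ↦ ?_⟩
  obtain ⟨c, hc, h⟩ := exists_wronskian
  have := h z
  rw [hz, hd] at this
  simp at this
  exact this.elim hc (dl_ne z)

lemma pencil_simple {τ : ℂ} (h0 : τ ≠ 0) (h1 : τ ≠ 1) : IsSimple (e4 ^ 3 - τ • e6 ^ 2) 12 := by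
  refine ⟨?_, ⟨1 - τ, sub_ne_zero.2 (Ne.symm h1), ?_⟩, fun z hz hd ↦ ?_⟩
  · exact Submodule.sub_mem _ (MF.pow e4_mem 3) (Submodule.smul_mem _ _ (MF.pow e6_mem 2))
  · have := (e4_lim.pow 3).sub ((e6_lim.pow 2).const_mul τ)
    rw [one_pow, one_pow, mul_one] at this
    exact this
  · obtain ⟨c, hc, h⟩ := exists_wronskian
    have hU : upperHalfPlaneSet ∈ 𝓝 (z : ℂ) := isOpen_upperHalfPlaneSet.mem_nhds z.im_pos
    have d4 := ((UpperHalfPlane.mdifferentiable_iff.1 e4_mem.1).differentiableAt hU).hasDerivAt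
    have d6 := ((UpperHalfPlane.mdifferentiable_iff.1 e6_mem.1).differentiableAt hU).hasDerivAt
    have hd' : HasDerivAt ((e4 ^ 3 - τ • e6 ^ 2) ∘ ofComplex) _ (z : ℂ) :=
      (d4.pow 3).sub ((d6.pow 2).const_mul τ)
    rw [hd'.deriv] at hd
    have hw := h z
    simp only [Pi.sub_apply, Pi.pow_apply, Pi.smul_apply, smul_eq_mul] at hz
    simp only [Function.comp_apply, ofComplex_apply] at hd
    set a := e4 z
    set b := e6 z
    set a' := deriv (e4 ∘ ofComplex) (z : ℂ)
    set b' := deriv (e6 ∘ ofComplex) (z : ℂ)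
    have h2 : a ^ 2 * (2 * a * b' - 3 * b * a') = 0 := by
      push_cast at hd
      linear_combination 2 * b' * hz - b * hd
    rw [hw] at h2
    have ha : a = 0 := by simpa [hc, dl_ne z] using h2
    have hb : b = 0 := by
      rw [ha] at hz; simpa [h0] using hz
    exact (e4_or_e6_ne z).elim (fun h ↦ h ha) (fun h ↦ h hb)

/-! ### Level one structure -/

lemma tendsto_of_mem (hf : f ∈ MF ⊤ k) : ∃ c, Tendsto f atImInfty (𝓝 c) := by
  obtain ⟨F, rfl⟩ := exists_modularForm hf
  exact ⟨_, (tendsto_deriv_div F).1⟩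

lemma CF_top_of_zero (hf : f ∈ MF ⊤ k) (h : IsZeroAtImInfty f) : f ∈ CF ⊤ k :=
  ⟨hf.1, hf.2.1, fun γ ↦ by rwa [hf.2.1 γ trivial]⟩

lemma CF_top_eq (hf : f ∈ CF ⊤ k) : ∃ h ∈ MF ⊤ (k - 12), f = dl * h := by
  obtain ⟨F, rfl⟩ := exists_cuspForm hf
  refine ⟨_, mem_MF_top (CuspForm.discriminantEquiv F), ?_⟩
  ext z
  exact (discriminant_mul_discriminantEquiv_apply F z).symm

lemma MF_top_two (hf : f ∈ MF ⊤ 2) : f = 0 := by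
  obtain ⟨F, rfl⟩ := exists_modularForm hf
  rw [rank_zero_iff_forall_zero.1 levelOne_weight_two_rank_zero F]
  rfl

lemma MF_top_odd (hk : Odd k) (hf : f ∈ MF ⊤ k) : f = 0 := by
  obtain ⟨F, rfl⟩ := exists_modularForm hf
  rw [levelOne_odd_weight_eq_zero hk F]
  rfl

lemma monomial_mem (a b : ℕ) : e4 ^ a * e6 ^ b ∈ MF Γ (4 * a + 6 * b) := by
  have := MF.mul (MF.pow (Γ := Γ) e4_mem' a) (MF.pow e6_mem' b)
  rwa [mul_comm (a : ℤ), mul_comm (b : ℤ)] at this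

lemma span_monomials (n : ℕ) : ∀ f ∈ MF ⊤ (2 * n),
    f ∈ Submodule.span ℂ {F : ℍ → ℂ | ∃ a b, 2 * a + 3 * b = n ∧ F = e4 ^ a * e6 ^ b} := by
  induction n using Nat.strong_induction_on with
  | _ n ih =>
    intro f hf
    by_cases hn1 : n = 1
    · subst hn1
      rw [MF_top_two hf]; exact zero_mem _
    obtain ⟨a, b, hab⟩ : ∃ a b, 2 * a + 3 * b = n := by
      rcases Nat.even_or_odd' n with ⟨m, rfl | rfl⟩
      · exact ⟨m, 0, by ring⟩
      · exact ⟨m - 1, 1, by omega⟩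
    have hm := monomial_mem (Γ := ⊤) a b
    rw [show 4 * (a : ℤ) + 6 * b = 2 * n by rw [← hab]; push_cast; ring] at hm
    obtain ⟨c, hc⟩ := tendsto_of_mem hf
    have hl : Tendsto (e4 ^ a * e6 ^ b) atImInfty (𝓝 1) := by
      have := (e4_lim.pow a).mul (e6_lim.pow b)
      rw [one_pow, one_pow, mul_one] at this
      exact this
    have hz : f - c • (e4 ^ a * e6 ^ b) ∈ CF ⊤ (2 * n) := by
      refine CF_top_of_zero (Submodule.sub_mem _ hf (Submodule.smul_mem _ _ hm)) ?_
      have := hc.sub (hl.const_mul c)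
      rw [mul_one, sub_self] at this
      exact this
    obtain ⟨h, hh, he⟩ := CF_top_eq hz
    have hmem : c • (e4 ^ a * e6 ^ b) ∈
        Submodule.span ℂ {F : ℍ → ℂ | ∃ a b, 2 * a + 3 * b = n ∧ F = e4 ^ a * e6 ^ b} :=
      Submodule.smul_mem _ _ (Submodule.subset_span ⟨a, b, hab, rfl⟩)
    rw [sub_eq_iff_eq_add] at he
    rw [he]
    refine Submodule.add_mem _ ?_ hmem
    rcases lt_or_ge n 6 with hn | hn
    · have : h = 0 := MF_neg hh (by omega)
      rw [this, mul_zero]; exact zero_mem _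
    · obtain ⟨m, rfl⟩ := Nat.exists_eq_add_of_le hn
      have hs := ih m (by omega) h (by convert hh using 2; push_cast; ring)
      have hle : Submodule.span ℂ
          {F : ℍ → ℂ | ∃ a b, 2 * a + 3 * b = m ∧ F = e4 ^ a * e6 ^ b} ≤
          (Submodule.span ℂ {F : ℍ → ℂ | ∃ a b, 2 * a + 3 * b = 6 + m ∧
            F = e4 ^ a * e6 ^ b}).comap (LinearMap.mulLeft ℂ dl) := by
        rw [Submodule.span_le]
        rintro _ ⟨a, b, hab, rfl⟩
        have : dl * (e4 ^ a * e6 ^ b) = (1728⁻¹ : ℂ) • (e4 ^ (a + 3) * e6 ^ b) -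
            (1728⁻¹ : ℂ) • (e4 ^ a * e6 ^ (b + 2)) := by
          rw [dl_eq, smul_mul_assoc, ← smul_sub]; ring_nf
        rw [SetLike.mem_coe, Submodule.mem_comap, LinearMap.mulLeft_apply, this]
        exact Submodule.sub_mem _
          (Submodule.smul_mem _ _ (Submodule.subset_span ⟨_, _, by omega, rfl⟩))
          (Submodule.smul_mem _ _ (Submodule.subset_span ⟨_, _, by omega, rfl⟩))
      exact hle hs

/-- Reduction of level one forms modulo `P` can be checked on monomials. -/
lemma reduce_mod {n : ℕ} (m : ℍ → ℂ)
    (h : ∀ a b, 2 * a + 3 * b = n → ∃ α : ℂ, ∃ D ∈ MF ⊤ (2 * n - p),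
      e4 ^ a * e6 ^ b = α • m + P * D) (hf : f ∈ MF ⊤ (2 * n)) :
    ∃ α : ℂ, ∃ D ∈ MF ⊤ (2 * n - p), f = α • m + P * D := by
  have h1 := span_monomials n f hf
  have hle : Submodule.span ℂ {F : ℍ → ℂ | ∃ a b, 2 * a + 3 * b = n ∧ F = e4 ^ a * e6 ^ b} ≤
      Submodule.span ℂ {m} ⊔ (MF ⊤ (2 * n - p)).map (LinearMap.mulLeft ℂ P) := by
    rw [Submodule.span_le]
    rintro _ ⟨a, b, hab, rfl⟩
    obtain ⟨α, D, hD, he⟩ := h a b hab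
    rw [he]
    exact Submodule.add_mem_sup (Submodule.smul_mem _ _ (Submodule.mem_span_singleton_self m))
      ⟨D, hD, rfl⟩
  obtain ⟨x, hx, y, ⟨D, hD, rfl⟩, rfl⟩ := Submodule.mem_sup.1 (hle h1)
  obtain ⟨α, rfl⟩ := Submodule.mem_span_singleton.1 hx
  exact ⟨α, D, hD, rfl⟩

lemma reduce_e4 {n b : ℕ} (hb : n = 3 * b) (hf : f ∈ MF ⊤ (2 * n)) :
    ∃ α : ℂ, ∃ D ∈ MF ⊤ (2 * n - 4), f = α • e6 ^ b + e4 * D := by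
  refine reduce_mod _ (fun a b' hab ↦ ?_) hf
  rcases Nat.eq_zero_or_pos a with rfl | ha
  · refine ⟨1, 0, zero_mem _, ?_⟩
    obtain rfl : b = b' := by omega
    simp
  · refine ⟨0, e4 ^ (a - 1) * e6 ^ b', ?_, ?_⟩
    · convert monomial_mem (Γ := ⊤) (a - 1) b' using 2
      rw [← hab]; push_cast [Nat.cast_sub ha]; ring
    · rw [zero_smul, zero_add, ← mul_assoc, ← pow_succ', Nat.sub_add_cancel ha]

lemma reduce_e4_of_not {n : ℕ} (hb : ¬ 3 ∣ n) (hf : f ∈ MF ⊤ (2 * n)) :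
    ∃ D ∈ MF ⊤ (2 * n - 4), f = e4 * D := by
  obtain ⟨α, D, hD, rfl⟩ : ∃ α : ℂ, ∃ D ∈ MF ⊤ (2 * n - 4), f = α • (0 : ℍ → ℂ) + e4 * D := by
    refine reduce_mod _ (fun a b' hab ↦ ?_) hf
    have ha : 1 ≤ a := by
      by_contra h
      exact hb ⟨b', by omega⟩
    refine ⟨0, e4 ^ (a - 1) * e6 ^ b', ?_, ?_⟩
    · convert monomial_mem (Γ := ⊤) (a - 1) b' using 2
      rw [← hab]; push_cast [Nat.cast_sub ha]; ring
    · rw [zero_smul, zero_add, ← mul_assoc, ← pow_succ', Nat.sub_add_cancel ha]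
  exact ⟨D, hD, by simp⟩

lemma reduce_e6 {n b : ℕ} (hb : n = 2 * b) (hf : f ∈ MF ⊤ (2 * n)) :
    ∃ α : ℂ, ∃ D ∈ MF ⊤ (2 * n - 6), f = α • e4 ^ b + e6 * D := by
  refine reduce_mod _ (fun a b' hab ↦ ?_) hf
  rcases Nat.eq_zero_or_pos b' with rfl | ha
  · refine ⟨1, 0, zero_mem _, ?_⟩
    obtain rfl : b = a := by omega
    simp
  · refine ⟨0, e4 ^ a * e6 ^ (b' - 1), ?_, ?_⟩
    · convert monomial_mem (Γ := ⊤) a (b' - 1) using 2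
      rw [← hab]; push_cast [Nat.cast_sub ha]; ring
    · rw [zero_smul, zero_add, mul_left_comm, ← pow_succ', Nat.sub_add_cancel ha]

lemma reduce_e6_of_not {n : ℕ} (hb : ¬ 2 ∣ n) (hf : f ∈ MF ⊤ (2 * n)) :
    ∃ D ∈ MF ⊤ (2 * n - 6), f = e6 * D := by
  obtain ⟨α, D, hD, rfl⟩ : ∃ α : ℂ, ∃ D ∈ MF ⊤ (2 * n - 6), f = α • (0 : ℍ → ℂ) + e6 * D := by
    refine reduce_mod _ (fun a b' hab ↦ ?_) hf
    have ha : 1 ≤ b' := by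
      by_contra h
      exact hb ⟨a, by omega⟩
    refine ⟨0, e4 ^ a * e6 ^ (b' - 1), ?_, ?_⟩
    · convert monomial_mem (Γ := ⊤) a (b' - 1) using 2
      rw [← hab]; push_cast [Nat.cast_sub ha]; ring
    · rw [zero_smul, zero_add, mul_left_comm, ← pow_succ', Nat.sub_add_cancel ha]
  exact ⟨D, hD, by simp⟩

lemma reduce_monomial (τ : ℂ) (a : ℕ) : ∀ b, ∃ a' b', a' ≤ 2 ∧ 2 * a' + 3 * b' = 2 * a + 3 * b ∧
    ∃ α : ℂ, ∃ D ∈ MF ⊤ (2 * (2 * a + 3 * b : ℕ) - 12),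
      e4 ^ a * e6 ^ b = α • (e4 ^ a' * e6 ^ b') + (e4 ^ 3 - τ • e6 ^ 2) * D := by
  induction a using Nat.strong_induction_on with
  | _ a ih =>
    intro b
    rcases le_or_gt a 2 with ha | ha
    · exact ⟨a, b, ha, rfl, 1, 0, zero_mem _, by simp⟩
    · obtain ⟨c, rfl⟩ := Nat.exists_eq_add_of_le' (show 3 ≤ a from ha)
      obtain ⟨a', b', h1, h2, α, D, hD, he⟩ := ih c (by omega) (b + 2)
      refine ⟨a', b', h1, by omega, τ * α, e4 ^ c * e6 ^ b + τ • D, ?_, ?_⟩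
      · refine Submodule.add_mem _ ?_ (Submodule.smul_mem _ _ ?_)
        · convert monomial_mem (Γ := ⊤) c b using 2
          push_cast; ring
        · convert hD using 2
          push_cast; ring
      · have : e4 ^ (c + 3) * e6 ^ b = (e4 ^ 3 - τ • e6 ^ 2) * (e4 ^ c * e6 ^ b) +
            τ • (e4 ^ c * e6 ^ (b + 2)) := by
          ext z; simp; ring
        rw [this, he]
        ext z; simp; ring

lemma reduce_pencil (τ : ℂ) {n a b : ℕ} (ha : a ≤ 2) (hab : 2 * a + 3 * b = n)
    (hf : f ∈ MF ⊤ (2 * n)) : ∃ α : ℂ, ∃ D ∈ MF ⊤ (2 * n - 12),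
      f = α • (e4 ^ a * e6 ^ b) + (e4 ^ 3 - τ • e6 ^ 2) * D := by
  refine reduce_mod _ (fun a₁ b₁ h₁ ↦ ?_) hf
  obtain ⟨a', b', h1, h2, α, D, hD, he⟩ := reduce_monomial τ a₁ b₁
  obtain rfl : a' = a := by omega
  obtain rfl : b' = b := by omega
  rw [h₁] at hD
  exact ⟨α, D, hD, he⟩

/-- A nonzero level one form vanishing at `z₀` is divisible by a form with simple zeros that
vanishes at `z₀`. -/
lemma exists_simple_factor {D : ℍ → ℂ} (hD : D ∈ MF ⊤ w) (hD0 : D ≠ 0) {z₀ : ℍ} (hz : D z₀ = 0) :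
    ∃ P p, 0 < p ∧ IsSimple P p ∧ P z₀ = 0 ∧ ∃ D' ∈ MF ⊤ (w - p), D = P * D' := by
  have hw : 0 ≤ w := by
    by_contra! h
    exact hD0 (MF_neg hD h)
  have hev : Even w := by
    rw [← Int.not_odd_iff_even]
    exact fun h ↦ hD0 (MF_top_odd h hD)
  obtain ⟨n, rfl⟩ : ∃ n : ℕ, w = 2 * n := by
    obtain ⟨r, rfl⟩ := hev
    exact ⟨r.toNat, by omega⟩
  by_cases h4 : e4 z₀ = 0
  · refine ⟨e4, 4, by norm_num, e4_simple, h4, ?_⟩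
    by_cases h3 : 3 ∣ n
    · obtain ⟨b, hb⟩ := h3
      obtain ⟨α, D', hD', rfl⟩ := reduce_e4 hb hD
      have : α = 0 := by
        simpa [h4, (e4_or_e6_ne z₀).resolve_left (not_not.2 h4)] using hz
      exact ⟨D', hD', by simp [this]⟩
    · exact reduce_e4_of_not h3 hD
  by_cases h6 : e6 z₀ = 0
  · refine ⟨e6, 6, by norm_num, e6_simple, h6, ?_⟩
    by_cases h2 : 2 ∣ n
    · obtain ⟨b, hb⟩ := h2
      obtain ⟨α, D', hD', rfl⟩ := reduce_e6 hb hD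
      have : α = 0 := by simpa [h6, h4] using hz
      exact ⟨D', hD', by simp [this]⟩
    · exact reduce_e6_of_not h2 hD
  set τ := e4 z₀ ^ 3 / e6 z₀ ^ 2 with hτ
  have hP : (e4 ^ 3 - τ • e6 ^ 2) z₀ = 0 := by
    simp [hτ, h6]
  refine ⟨_, 12, by norm_num, pencil_simple (τ := τ) ?_ ?_, hP, ?_⟩
  · exact div_ne_zero (pow_ne_zero _ h4) (pow_ne_zero _ h6)
  · intro h
    refine dl_ne z₀ ?_
    rw [h, one_smul] at hP
    rw [dl_eq, Pi.smul_apply, hP, smul_zero]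
  · by_cases hn1 : n = 1
    · subst hn1
      exact absurd (MF_top_two hD) hD0
    obtain ⟨a, b, ha, hab⟩ : ∃ a b, a ≤ 2 ∧ 2 * a + 3 * b = n := by
      have : n % 3 = 0 ∨ n % 3 = 1 ∨ n % 3 = 2 := by omega
      rcases this with h | h | h
      · exact ⟨0, n / 3, by omega, by omega⟩
      · exact ⟨2, (n - 4) / 3, by omega, by omega⟩
      · exact ⟨1, (n - 2) / 3, by omega, by omega⟩
    obtain ⟨α, D', hD', rfl⟩ := reduce_pencil τ ha hab hD
    refine ⟨D', hD', ?_⟩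
    have : α = 0 := by
      simpa [-Pi.sub_apply, hP, h4, h6] using hz
    simp [this]

end

section

/-! ### Growth at the cusp -/

/-- The local parameter of width `h`. -/
def qp (h : ℕ) (z : ℍ) : ℂ := Function.Periodic.qParam h z

lemma qp_ne (h : ℕ) (z : ℍ) : qp h z ≠ 0 := Function.Periodic.qParam_ne_zero _

lemma qp_tendsto {h : ℕ} (hh : 0 < h) : Tendsto (qp h) atImInfty (𝓝 0) :=
  qParam_tendsto_atImInfty (by exact_mod_cast hh)

lemma qp_norm {h : ℕ} (hh : 0 < h) (z : ℍ) : ‖qp h z ^ h‖ = Real.exp (-2 * Real.pi * z.im) := by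
  rw [norm_pow, qp, Function.Periodic.norm_qParam, ← Real.exp_nat_mul]
  congr 1
  have : (h : ℝ) ≠ 0 := by positivity
  rw [coe_im]
  field_simp

lemma qp_mdiff (h : ℕ) : MDiff (qp h) := by
  rw [UpperHalfPlane.mdifferentiable_iff]
  have : DifferentiableOn ℂ (Function.Periodic.qParam h) {z | 0 < z.im} :=
    (Function.Periodic.differentiable_qParam).differentiableOn
  refine this.congr fun z hz ↦ ?_
  simp [qp, ofComplex_apply_of_im_pos hz]

lemma qp_periodic (h : ℕ) : Function.Periodic (Function.Periodic.qParam h) (h : ℂ) := by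
  intro z
  rcases eq_or_ne (h : ℂ) 0 with h0 | h0
  · simp [h0]
  · simp only [Function.Periodic.qParam, Complex.ofReal_natCast]
    rw [mul_add, add_div, mul_div_assoc _ (h : ℂ), div_self h0, mul_one, Complex.exp_periodic]

lemma dl_isBigO_qp {h : ℕ} (hh : 0 < h) : dl =O[atImInfty] fun z ↦ qp h z ^ h := by
  have := CuspFormClass.exp_decay_atImInfty (h := 1) CuspForm.discriminant one_pos
    one_mem_strictPeriods_SL
  refine IsBigO.trans this (IsBigO.of_bound 1 (.of_forall fun z ↦ ?_))
  rw [qp_norm hh, Real.norm_eq_abs, abs_of_pos (Real.exp_pos _), div_one, one_mul]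

lemma qp_isBigO_dl {h : ℕ} (hh : 0 < h) : (fun z ↦ qp h z ^ h) =O[atImInfty] dl := by
  refine IsBigO.trans (IsBigO.of_bound 1 (.of_forall fun z ↦ ?_)) exp_isBigO_discriminant
  rw [qp_norm hh, Real.norm_eq_abs, abs_of_pos (Real.exp_pos _), one_mul]

lemma tendsto_zero_of_power_sums {ι α : Type*} [Fintype ι] {F : Filter α} (Y : ι → α → ℂ)
    (hb : ∀ i, Y i =O[F] (1 : α → ℝ))
    (h : ∀ n : ℕ, Tendsto (fun z ↦ ∑ i, Y i z ^ (n + 1)) F (𝓝 0)) (i : ι) :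
    Tendsto (Y i) F (𝓝 0) := by
  rw [Filter.tendsto_iff_ultrafilter]
  intro g hg
  have hL : ∀ j, ∃ c, Tendsto (Y j) g (𝓝 c) := by
    intro j
    obtain ⟨C, hC⟩ := (hb j).bound
    have hC' : ∀ᶠ z in g, Y j z ∈ Metric.closedBall (0 : ℂ) C := by
      filter_upwards [hg hC] with z hz
      simpa using hz
    obtain ⟨c, -, hc⟩ := (isCompact_closedBall (0 : ℂ) C).ultrafilter_le_nhds (g.map (Y j))
      (by rw [Filter.le_principal_iff]; exact hC')
    exact ⟨c, hc⟩
  choose L hL using hL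
  have h0 : ∀ n : ℕ, ∑ j, L j ^ (n + 1) = 0 := fun n ↦
    tendsto_nhds_unique (tendsto_finsetSum _ fun j _ ↦ (hL j).pow (n + 1)) ((h n).mono_left hg)
  rw [← eq_zero_of_power_sums L h0 i]
  exact hL i

lemma bounded_pow (hf : IsBoundedAtImInfty f) (n : ℕ) : IsBoundedAtImInfty (f ^ n) := by
  induction n with
  | zero => exact const_boundedAtFilter _ _
  | succ n ih => rw [pow_succ]; exact ih.mul hf

lemma growth_core {ι : Type*} [Fintype ι] {h : ℕ} (hh : 0 < h) (y : ι → ℍ → ℂ)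
    (hy : ∀ q, MDiff (y q)) (hper : ∀ q, Function.Periodic (y q ∘ ofComplex) h)
    (hbig : ∃ a : ℕ, ∀ q, IsBoundedAtImInfty (y q * qp h ^ a))
    (H : ∀ n c : ℕ, (∀ q, IsBoundedAtImInfty (y q ^ n * dl ^ c)) →
      IsBoundedAtImInfty (∑ q, y q ^ (n + 1) * dl ^ c)) (q : ι) :
    IsZeroAtImInfty (y q * dl) := by
  classical
  set a := Nat.find hbig
  have ha : ∀ q, IsBoundedAtImInfty (y q * qp h ^ a) := Nat.find_spec hbig
  have hmin : ∀ b < a, ¬ ∀ q, IsBoundedAtImInfty (y q * qp h ^ b) := fun b hb ↦ Nat.find_min hbig hb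
  have hdb : IsBoundedAtImInfty (dl / qp h ^ h) := by
    have := (dl_isBigO_qp hh).mul (isBigO_refl (fun z ↦ (qp h z ^ h)⁻¹) atImInfty)
    refine this.trans (IsBigO.of_bound 1 (.of_forall fun z ↦ ?_))
    simp [qp_ne]
  have hbd : IsBoundedAtImInfty (qp h ^ h / dl) := by
    have := (qp_isBigO_dl hh).mul (isBigO_refl (fun z ↦ (dl z)⁻¹) atImInfty)
    refine this.trans (IsBigO.of_bound 1 (.of_forall fun z ↦ ?_))
    simp [dl_ne]
  have hq0 : ∀ n, 0 < n → IsZeroAtImInfty (qp h ^ n) := fun n hn ↦ by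
    have := (qp_tendsto hh).pow n
    rwa [zero_pow hn.ne'] at this
  have hqb : ∀ n, IsBoundedAtImInfty (qp h ^ n) := fun n ↦
    ((qp_tendsto hh).pow n).isBigO_one ℝ
  by_cases hah : a < h
  · have h1 : IsZeroAtImInfty (((y q * qp h ^ a) * (dl / qp h ^ h)) * qp h ^ (h - a)) :=
      ((ha q).mul hdb).mul_zeroAtFilter (hq0 _ (by omega))
    refine h1.congr fun z ↦ ?_
    have := qp_ne h z
    simp only [Pi.mul_apply, Pi.div_apply, Pi.pow_apply]
    field_simp
    rw [← Nat.sub_add_cancel hah.le, pow_add, Nat.add_sub_cancel]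
    ring
  push Not at hah
  exfalso
  refine hmin (a - 1) (by omega) fun q ↦ ?_
  have key : ∀ q, IsZeroAtImInfty (y q * qp h ^ a) := by
    refine tendsto_zero_of_power_sums _ ha fun n ↦ ?_
    obtain ⟨c, d, e, hcd, hce, he⟩ : ∃ c d e, h * c = n * a + d ∧ (n + 1) * a = h * c + e ∧ 0 < e := by
      have e1 := Nat.div_add_mod (n * a + h - 1) h
      have e2 := Nat.mod_lt (n * a + h - 1) hh
      set c := (n * a + h - 1) / h
      refine ⟨c, h * c - n * a, (n + 1) * a - h * c, ?_, ?_, ?_⟩ <;> try rw [add_mul, one_mul]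
      all_goals omega
    have h1 : ∀ q, IsBoundedAtImInfty (y q ^ n * dl ^ c) := fun q ↦ by
      have h2 : IsBoundedAtImInfty ((y q * qp h ^ a) ^ n * (dl / qp h ^ h) ^ c * qp h ^ d) :=
        ((bounded_pow (ha q) n).mul (bounded_pow hdb c)).mul (hqb d)
      refine h2.congr_left fun z ↦ ?_
      have := qp_ne h z
      simp only [Pi.mul_apply, Pi.div_apply, Pi.pow_apply]
      rw [mul_pow, div_pow, ← pow_mul, ← pow_mul, hcd, mul_comm a n, pow_add]
      field_simp
    have h3 : IsZeroAtImInfty ((∑ q, y q ^ (n + 1) * dl ^ c) * (qp h ^ h / dl) ^ c * qp h ^ e) :=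
      ((H n c h1).mul (bounded_pow hbd c)).mul_zeroAtFilter (hq0 e he)
    refine h3.congr fun z ↦ ?_
    have := dl_ne z
    simp only [Pi.mul_apply, Pi.div_apply, Pi.pow_apply, Finset.sum_apply, Finset.sum_mul]
    refine Finset.sum_congr rfl fun q _ ↦ ?_
    rw [mul_pow, div_pow, ← pow_mul, ← pow_mul, mul_comm a, hce, pow_add, pow_add]
    field_simp
  have := UpperHalfPlane.IsZeroAtImInfty.exp_decay_atImInfty (key q) (h := h)
    (by positivity) ?_ ((hy q).mul ((qp_mdiff h).pow a)) (ha q)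
  · have h4 : (y q * qp h ^ a) =O[atImInfty] qp h :=
      this.trans (IsBigO.of_bound 1 (.of_forall fun z ↦ by
        rw [qp, Function.Periodic.norm_qParam, Real.norm_eq_abs, abs_of_pos (Real.exp_pos _),
          one_mul, coe_im]))
    have h5 := h4.mul (isBigO_refl (fun z ↦ (qp h z)⁻¹) atImInfty)
    refine (h5.congr_left fun z ↦ ?_).trans (IsBigO.of_bound 1 (.of_forall fun z ↦ ?_))
    · have := qp_ne h z
      obtain ⟨b, hb⟩ : ∃ b, a = b + 1 := ⟨a - 1, by omega⟩
      simp only [Pi.mul_apply, Pi.pow_apply, hb, Nat.add_sub_cancel, pow_succ]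
      field_simp
    · simp [qp_ne]
  · intro z
    have e1 := hper q z
    have e2 : (qp h ∘ ofComplex) (z + h) = (qp h ∘ ofComplex) z := by
      by_cases hz : 0 < z.im
      · have hz' : 0 < (z + h).im := by simpa using hz
        simp [qp, ofComplex_apply_of_im_pos hz, ofComplex_apply_of_im_pos hz', qp_periodic h z]
      · have hz' : (z + h).im ≤ 0 := by simpa using hz
        simp [ofComplex_apply_of_im_nonpos (not_lt.1 hz), ofComplex_apply_of_im_nonpos hz']
    simp only [Function.comp_apply, Pi.mul_apply, Pi.pow_apply, Complex.ofReal_natCast] at e1 e2 ⊢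
    rw [e1, e2]

lemma exists_dl_pow_isBigO (hD : f ∈ MF ⊤ w) (h0 : f ≠ 0) :
    ∃ m : ℕ, (dl ^ m) =O[atImInfty] f := by
  induction hn : w.toNat using Nat.strong_induction_on generalizing w f with
  | _ n ih =>
    obtain ⟨c, hc⟩ := tendsto_of_mem hD
    by_cases hc0 : c = 0
    · subst hc0
      obtain ⟨g, hg, rfl⟩ := CF_top_eq (CF_top_of_zero hD hc)
      have hw : 0 ≤ w - 12 := by
        by_contra! h
        exact h0 (by rw [MF_neg hg h, mul_zero])
      obtain ⟨m, hm⟩ := ih _ (by omega) hg (by rintro rfl; simp at h0) rfl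
      refine ⟨m + 1, ?_⟩
      rw [pow_succ, mul_comm]
      exact (isBigO_refl dl _).mul hm
    · refine ⟨0, ?_⟩
      have h1 : (fun _ ↦ (1 : ℂ)) =O[atImInfty] f := by
        have := (isBigO_refl f atImInfty).mul ((hc.inv₀ hc0).isBigO_one ℂ)
        simp only [mul_one] at this
        refine this.congr' ?_ .rfl
        filter_upwards [hc.eventually_ne hc0] with z hz
        simp [hz]
      exact h1

lemma exists_periodic [Γ.FiniteIndex] (hf : ∀ γ ∈ Γ, f ∣[k] γ = f) :
    ∃ h : ℕ, 0 < h ∧ ∀ q : SL(2, ℤ) ⧸ Γ, Function.Periodic (comp k f q ∘ ofComplex) h := by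
  set σ := MulAction.toPermHom SL(2, ℤ) (SL(2, ℤ) ⧸ Γ) ModularGroup.T with hσ
  refine ⟨orderOf σ, orderOf_pos σ, fun q ↦ ?_⟩
  have h1 : ModularGroup.T ^ orderOf σ • q = q := by
    have := congrArg (fun τ ↦ τ q) (pow_orderOf_eq_one σ)
    rw [hσ, ← map_pow] at this
    exact this
  have h2 : comp k f q ∣[k] (ModularGroup.T ^ orderOf σ) = comp k f q := by
    rw [comp_slash hf, inv_smul_eq_iff.2 h1.symm]
  intro z
  by_cases hz : 0 < z.im
  · have hz' : 0 < (z + orderOf σ).im := by simpa using hz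
    have h3 := congrFun h2 ⟨z, hz⟩
    rw [SL_slash_apply] at h3
    simp only [Function.comp_apply, ofComplex_apply_of_im_pos hz, ofComplex_apply_of_im_pos hz']
    rw [← h3]
    have h4 : ModularGroup.T ^ orderOf σ • (⟨z, hz⟩ : ℍ) = ⟨z + orderOf σ, hz'⟩ := by
      apply UpperHalfPlane.ext
      have := ModularGroup.coe_T_zpow_smul_eq ⟨z, hz⟩ (n := (orderOf σ : ℤ))
      rw [zpow_natCast] at this
      rw [this]
      simp
    have h5 : denom (Matrix.SpecialLinearGroup.toGL ((Matrix.SpecialLinearGroup.map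
        (Int.castRingHom ℝ)) (ModularGroup.T ^ orderOf σ))) z = 1 := by
      have h6 := ModularGroup.coe_T_zpow (orderOf σ : ℤ)
      rw [zpow_natCast] at h6
      simp only [denom, Matrix.SpecialLinearGroup.toGL]
      simp [-map_pow, -Matrix.SpecialLinearGroup.coe_pow, h6]
    rw [h4]
    erw [h5]
    simp
  · have hz' : (z + orderOf σ).im ≤ 0 := by simpa using hz
    simp [ofComplex_apply_of_im_nonpos (not_lt.1 hz), ofComplex_apply_of_im_nonpos hz']

/-! ### The dual lemma -/

variable {D y : ℍ → ℂ} {W V : ℤ}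

lemma dual_of_ne_zero [Γ.FiniteIndex] (hD : D ∈ MF ⊤ W) (hne : ∀ z, D z ≠ 0) (hW : Even W)
    (hy : y ∈ MF Γ V) (hV : Even V)
    (H : ∀ w, Even w → ∀ f ∈ MF Γ w, ∃ h ∈ MF ⊤ (V + w - W), tr Γ (V + w) (y * f) = D * h) :
    ∃ φ ∈ CF Γ (V - W + 12), D * φ = y * dl := by
  have hD0 : D ≠ 0 := fun h ↦ hne I (congrFun h _)
  obtain ⟨u, hu, rfl⟩ := exists_mdiff_quotient (G := y) hD.1 hy.1
    (fun z hz ↦ absurd hz (hne z)) (fun z hz ↦ absurd hz (hne z))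
  obtain ⟨K, rfl⟩ : ∃ K, V = W + K := ⟨V - W, by ring⟩
  have hus : ∀ γ ∈ Γ, u ∣[K] γ = u := fun γ hγ ↦
    slash_eq_of_mul_slash hD0 hD.1 (hD.2.1 γ trivial) hu (hy.2.1 γ hγ)
  have hcomp : ∀ q : SL(2, ℤ) ⧸ Γ, IsBoundedAtImInfty (D * comp K u q) := fun q ↦ by
    have : IsBoundedAtImInfty (comp (W + K) (D * u) q) := hy.2.2 _
    rwa [comp_mul, comp_level_one hD] at this
  obtain ⟨h, hh, hper⟩ := exists_periodic (k := K) hus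
  have hbig : ∃ a : ℕ, ∀ q : SL(2, ℤ) ⧸ Γ, IsBoundedAtImInfty (comp K u q * qp h ^ a) := by
    obtain ⟨m, hm⟩ := exists_dl_pow_isBigO hD hD0
    refine ⟨h * m, fun q ↦ ?_⟩
    have h1 : (qp h ^ (h * m)) =O[atImInfty] D := by
      rw [pow_mul]; exact ((qp_isBigO_dl hh).pow m).trans hm
    rw [mul_comm]
    exact (h1.mul (isBigO_refl (comp K u q) _)).trans (hcomp q)
  have hslash : ∀ (n c : ℕ) (q : SL(2, ℤ) ⧸ Γ),
      comp (n * K + c * 12) (u ^ n * dl ^ c) q = comp K u q ^ n * dl ^ c := fun n c q ↦ by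
    rw [comp_mul, comp_pow, comp_pow, comp_level_one (CF_le_MF dl_mem)]
  have hinv : ∀ (n c : ℕ), ∀ γ ∈ Γ, (u ^ n * dl ^ c) ∣[n * K + c * 12] γ = u ^ n * dl ^ c := by
    intro n c γ hγ
    rw [ModularForm.mul_slash_SL2, (MF.pow (CF_le_MF dl_mem) c).2.1 γ trivial]
    congr 1
    clear H
    induction n with
    | zero => simp [ModularForm.is_invariant_one]
    | succ n ih =>
      rw [pow_succ]; push_cast
      rw [add_mul, one_mul, ModularForm.mul_slash_SL2, ih, hus γ hγ]
  have hcore := growth_core hh (fun q : SL(2, ℤ) ⧸ Γ ↦ comp K u q) (fun q ↦ comp_mdiff hu q) hper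
    hbig fun n c hb ↦ by
      have hf : u ^ n * dl ^ c ∈ MF Γ (n * K + c * 12) := by
        refine ⟨(hu.pow n).mul (dl_mem.1.pow c), hinv n c, fun γ ↦ ?_⟩
        have := hb ((γ⁻¹ : SL(2, ℤ)) : SL(2, ℤ) ⧸ Γ)
        rwa [← hslash, comp_mk (hinv n c), inv_inv] at this
      obtain ⟨g, hg, he⟩ := H _ (by
        have : Even K := by simpa [hW, parity_simps] using hV
        exact (this.mul_left _).add (Even.mul_left (by decide) _)) _ hf
      have : ∑ q : SL(2, ℤ) ⧸ Γ, comp K u q ^ (n + 1) * dl ^ c = g := by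
        ext z
        have h1 := congrFun he z
        rw [tr_def] at h1
        simp_rw [comp_mul, comp_pow, comp_level_one hD, comp_level_one (CF_le_MF dl_mem)] at h1
        refine mul_left_cancel₀ (hne z) ?_
        rw [← Pi.mul_apply, ← Pi.mul_apply, ← h1]
        simp only [Finset.sum_apply, Pi.mul_apply, Pi.pow_apply, Finset.mul_sum]
        exact Finset.sum_congr rfl fun q _ ↦ by ring
      rw [this]
      exact MF.bdd_self hg
  refine ⟨u * dl, ⟨hu.mul dl_mem.1, fun γ hγ ↦ ?_, fun γ ↦ ?_⟩, by ring⟩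
  · rw [add_sub_cancel_left, ModularForm.mul_slash_SL2, hus γ hγ, dl_mem.2.1 γ trivial]
  · have := hcore ((γ⁻¹ : SL(2, ℤ)) : SL(2, ℤ) ⧸ Γ)
    rw [comp_mk hus, inv_inv] at this
    rwa [add_sub_cancel_left, ModularForm.mul_slash_SL2, dl_mem.2.1 γ trivial]

lemma dual [Γ.FiniteIndex] (hD : D ∈ MF ⊤ W) (hD0 : D ≠ 0)
    (hy : y ∈ MF Γ V) (hV : Even V)
    (H : ∀ w, Even w → ∀ f ∈ MF Γ w, ∃ h ∈ MF ⊤ (V + w - W), tr Γ (V + w) (y * f) = D * h) :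
    ∃ φ ∈ CF Γ (V - W + 12), D * φ = y * dl := by
  induction hn : W.toNat using Nat.strong_induction_on generalizing W V D y with
  | _ n ih =>
    have hW : 0 ≤ W := by
      by_contra! h
      exact hD0 (MF_neg hD h)
    by_cases hz : ∃ z₀, D z₀ = 0
    · obtain ⟨z₀, hz⟩ := hz
      obtain ⟨P, p, hp, hP, -, D', hD', rfl⟩ := exists_simple_factor hD hD0 hz
      have hpe : Even p := by
        rw [← Int.not_odd_iff_even]
        exact fun h ↦ hP.ne_zero (MF_top_odd h hP.mem)
      obtain ⟨y', hy', rfl⟩ := hP.exists_eq_mul hy fun z hPz ↦ by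
        have h1 := fun q ↦ eq_zero_of_power_sums (fun q : SL(2, ℤ) ⧸ Γ ↦ comp V y q z) (fun n ↦ ?_) q
        · have := h1 ((1 : SL(2, ℤ)) : SL(2, ℤ) ⧸ Γ)
          rwa [comp_one_coset hy.2.1] at this
        · obtain ⟨h, -, he⟩ := H _ (hV.mul_left n) _ (MF.pow hy n)
          have h2 := congrFun he z
          rw [tr_def] at h2
          simp_rw [comp_mul, comp_pow] at h2
          simpa [hPz, pow_succ'] using h2
      have hD'0 : D' ≠ 0 := by rintro rfl; simp at hD0
      have hWp : 0 ≤ W - p := by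
        by_contra! h
        exact hD'0 (MF_neg hD' h)
      obtain ⟨φ, hφ, he⟩ := ih _ (by omega) hD' hD'0 hy' (hV.sub hpe) (fun w hw f hf ↦ by
        obtain ⟨h, hh, he⟩ := H w hw f hf
        refine ⟨h, by convert hh using 1; congr 1; ring, ?_⟩
        refine mul_left_cancel_mdiff hP.ne_zero hP.mem.1 (tr_mem (MF.mul hy' hf)).1
          (hD'.1.mul hh.1) ?_
        rw [← tr_mul_level_one hP.mem, ← mul_assoc, ← mul_assoc, ← he]
        congr 2
        ring) rfl
      refine ⟨φ, by convert hφ using 1; congr 1; ring, ?_⟩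
      rw [mul_assoc, he, mul_assoc]
    · push Not at hz
      refine dual_of_ne_zero hD hz ?_ hy hV H
      rw [← Int.not_odd_iff_even]
      exact fun h ↦ hD0 (MF_top_odd h hD)

end

section

/-! ### Representing equivariant functionals by cusp forms -/

lemma MF.congr {a b : ℤ} (h : a = b) (hf : f ∈ MF Γ a) : f ∈ MF Γ b := h ▸ hf

lemma MF.prod {ι : Type*} {s : Finset ι} {w : ι → ℤ} {F : ι → ℍ → ℂ}
    (h : ∀ i ∈ s, F i ∈ MF Γ (w i)) : ∏ i ∈ s, F i ∈ MF Γ (∑ i ∈ s, w i) := by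
  classical
  induction s using Finset.induction_on with
  | empty => simpa using MF_one
  | insert a s ha ih =>
    rw [Finset.prod_insert ha, Finset.sum_insert ha]
    exact MF.mul (h a (by simp)) (ih fun i hi ↦ h i (by simp [hi]))

section Matrix

variable {ι : Type*} [Fintype ι] [DecidableEq ι]

lemma MF.det {ρ κ : ι → ℤ} {M : Matrix ι ι (ℍ → ℂ)} (h : ∀ i j, M i j ∈ MF Γ (ρ i + κ j)) :
    M.det ∈ MF Γ (∑ i, ρ i + ∑ j, κ j) := by
  rw [Matrix.det_apply]
  refine Submodule.sum_mem _ fun σ _ ↦ ?_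
  rw [Units.smul_def]
  refine zsmul_mem ?_ _
  rw [← Equiv.sum_comp σ ρ, ← Finset.sum_add_distrib]
  exact MF.prod fun i _ ↦ h _ _

lemma MF.adjugate {ρ κ : ι → ℤ} {M : Matrix ι ι (ℍ → ℂ)} (h : ∀ i j, M i j ∈ MF Γ (ρ i + κ j))
    (i j : ι) : M.adjugate j i ∈ MF Γ (∑ i, ρ i + ∑ j, κ j - ρ i - κ j) := by
  rw [Matrix.adjugate_apply]
  have := MF.det (ρ := Function.update ρ i (-κ j)) (κ := κ) (Γ := Γ)
    (M := M.updateRow i (Pi.single j 1)) fun a b ↦ by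
    rcases eq_or_ne a i with rfl | ha
    · rcases eq_or_ne b j with rfl | hb
      · simpa using MF_one
      · simp [hb]
    · simpa [ha] using h a b
  refine MF.congr ?_ this
  rw [Finset.sum_update_of_mem (Finset.mem_univ i), ← Finset.add_sum_erase _ ρ (Finset.mem_univ i),
    Finset.sdiff_singleton_eq_erase]
  ring

lemma bordered {R : Type*} [CommRing R] (A : Matrix ι ι R) (b : Matrix ι Unit R)
    (c : Matrix Unit ι R) (d : Matrix Unit Unit R) (h : (Matrix.fromBlocks A b c d).det = 0) :
    A.det ^ Fintype.card ι * (A.det * d () () - (c * A.adjugate * b) () ()) = 0 := by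
  have h1 : Matrix.fromBlocks A b c d *
      Matrix.fromBlocks A.adjugate (-(A.adjugate * b)) 0 (A.det • (1 : Matrix Unit Unit R)) =
      Matrix.fromBlocks (A.det • 1) 0 (c * A.adjugate) (A.det • d - c * A.adjugate * b) := by
    rw [Matrix.fromBlocks_multiply]
    congr 1
    · simp [Matrix.mul_adjugate]
    · simp [← Matrix.mul_assoc, Matrix.mul_adjugate]
    · simp
    · simp [← Matrix.mul_assoc, sub_eq_neg_add]
  have h2 := congrArg Matrix.det h1
  rw [Matrix.det_mul, h, zero_mul, Matrix.det_fromBlocks_zero₁₂] at h2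
  simpa [Matrix.det_unique] using h2.symm

lemma det_sum_eq_zero {α : Type*} [Fintype α] (h : Fintype.card α < Fintype.card ι)
    (a b : ι → α → ℂ) : (Matrix.of fun i j ↦ ∑ q, a i q * b j q).det = 0 := by
  by_contra h0
  have h1 : (Matrix.of fun i j ↦ ∑ q, a i q * b j q) = Matrix.of a * (Matrix.of b).transpose := by
    ext i j; simp [Matrix.mul_apply]
  have h2 := Matrix.rank_of_isUnit _ ((Matrix.isUnit_iff_isUnit_det _).2 (isUnit_iff_ne_zero.2 h0))
  rw [h1] at h2
  have h3 := Matrix.rank_mul_le_left (Matrix.of a) (Matrix.of b).transpose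
  have h4 := Matrix.rank_le_card_width (Matrix.of a)
  omega

end Matrix

lemma level_one_linear (Λ : ℤ → (ℍ → ℂ) →ₗ[ℂ] (ℍ → ℂ))
    (h4 : ∀ w, Even w → ∀ f ∈ MF Γ w, Λ (4 + w) (e4 * f) = e4 * Λ w f)
    (h6 : ∀ w, Even w → ∀ f ∈ MF Γ w, Λ (6 + w) (e6 * f) = e6 * Λ w f)
    {a : ℤ} {A : ℍ → ℂ} (hA : A ∈ MF ⊤ a) (hw : Even w) (hf : f ∈ MF Γ w) :
    Λ (a + w) (A * f) = A * Λ w f := by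
  rcases Int.even_or_odd a with ha | ha
  swap
  · simp [MF_top_odd ha hA]
  rcases lt_or_ge a 0 with h0 | h0
  · simp [MF_neg hA h0]
  obtain ⟨n, rfl⟩ : ∃ n : ℕ, a = 2 * n := by
    obtain ⟨r, rfl⟩ := ha
    exact ⟨r.toNat, by omega⟩
  have hmon6 : ∀ b : ℕ, Λ (6 * b + w) (e6 ^ b * f) = e6 ^ b * Λ w f := fun b ↦ by
    induction b with
    | zero => simp
    | succ b ih =>
      rw [pow_succ', mul_assoc, mul_assoc, ← ih, ← h6]
      · congr 2; push_cast; ring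
      · exact (Even.mul_right (by decide) _).add hw
      · exact MF.mul (MF.congr (by ring) (MF.pow e6_mem' b)) hf
  have hmon4 : ∀ a b : ℕ, Λ (4 * a + 6 * b + w) (e4 ^ a * e6 ^ b * f) =
      e4 ^ a * e6 ^ b * Λ w f := fun a b ↦ by
    induction a with
    | zero => simpa using hmon6 b
    | succ a ih =>
      rw [show e4 ^ (a + 1) * e6 ^ b * f = e4 * (e4 ^ a * e6 ^ b * f) by ring,
        show e4 ^ (a + 1) * e6 ^ b * Λ w f = e4 * (e4 ^ a * e6 ^ b * Λ w f) by ring, ← ih, ← h4]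
      · congr 2; push_cast; ring
      · exact ((Even.mul_right (by decide) _).add (Even.mul_right (by decide) _)).add hw
      · exact MF.mul (monomial_mem a b) hf
  have hsp := span_monomials n A hA
  clear hA
  induction hsp using Submodule.span_induction with
  | mem x hx =>
    obtain ⟨a, b, hab, rfl⟩ := hx
    rw [← hmon4]
    congr 2
    rw [← hab]; push_cast; ring
  | zero => simp
  | add x y _ _ hx hy => rw [add_mul, add_mul, map_add, hx, hy]
  | smul c x _ hx => rw [smul_mul_assoc, smul_mul_assoc, map_smul, hx]

variable [Γ.FiniteIndex]

variable (Γ) in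
/-- The Gram matrix of the trace pairing. -/
def gram {ι ι' : Type*} (ρ : ι → ℤ) (κ : ι' → ℤ) (e : ι → ℍ → ℂ) (g : ι' → ℍ → ℂ) :
    Matrix ι ι' (ℍ → ℂ) := Matrix.of fun i j ↦ tr Γ (ρ i + κ j) (e i * g j)

variable (Γ) in
/-- There are families of size `m` with nonzero Gram determinant. -/
def HasGram (m : ℕ) : Prop :=
  ∃ (ι : Type) (_ : Fintype ι) (_ : DecidableEq ι) (ρ κ : ι → ℤ) (e g : ι → ℍ → ℂ),
    Fintype.card ι = m ∧ (∀ i, Even (ρ i) ∧ e i ∈ MF Γ (ρ i)) ∧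
    (∀ i, Even (κ i) ∧ g i ∈ MF Γ (κ i)) ∧ (gram Γ ρ κ e g).det ≠ 0

lemma HasGram.le {m : ℕ} (h : HasGram Γ m) : m ≤ Fintype.card (SL(2, ℤ) ⧸ Γ) := by
  obtain ⟨ι, _, _, ρ, κ, e, g, rfl, he, hg, h0⟩ := h
  by_contra! hlt
  refine h0 ?_
  ext z
  have := RingHom.map_det (Pi.evalRingHom (fun _ : ℍ ↦ ℂ) z) (gram Γ ρ κ e g)
  rw [Pi.evalRingHom_apply] at this
  rw [this, Pi.zero_apply, ← det_sum_eq_zero hlt (fun i q ↦ comp (ρ i) (e i) q z)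
    (fun i q ↦ comp (κ i) (g i) q z)]
  congr 1
  ext i j
  simp [gram, tr_def, comp_mul]

lemma exists_max_gram : ∃ m, HasGram Γ m ∧ ¬ HasGram Γ (m + 1) := by
  by_contra! h
  have h0 : HasGram Γ 0 :=
    ⟨Fin 0, inferInstance, inferInstance, ![], ![], ![], ![], rfl, nofun, nofun, by
      rw [Matrix.det_isEmpty]; exact one_ne_zero⟩
  have : ∀ m, HasGram Γ m := fun m ↦ Nat.rec h0 h m
  have := (this (Fintype.card (SL(2, ℤ) ⧸ Γ) + 1)).le
  omega

lemma gram_mem {ι ι' : Type*} {ρ : ι → ℤ} {κ : ι' → ℤ} {e : ι → ℍ → ℂ} {g : ι' → ℍ → ℂ}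
    (he : ∀ i, e i ∈ MF Γ (ρ i)) (hg : ∀ j, g j ∈ MF Γ (κ j)) (i : ι) (j : ι') :
    gram Γ ρ κ e g i j ∈ MF ⊤ (ρ i + κ j) := tr_mem (MF.mul (he i) (hg j))

lemma exists_gram_expansion :
    ∃ (ι : Type) (_ : Fintype ι) (_ : DecidableEq ι) (ρ κ : ι → ℤ) (e g : ι → ℍ → ℂ),
    (∀ i, Even (ρ i) ∧ e i ∈ MF Γ (ρ i)) ∧ (∀ i, Even (κ i) ∧ g i ∈ MF Γ (κ i)) ∧
    (gram Γ ρ κ e g).det ≠ 0 ∧ ∀ w, Even w → ∀ f ∈ MF Γ w, (gram Γ ρ κ e g).det * f =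
      ∑ i, ∑ j, tr Γ (w + κ j) (f * g j) * (gram Γ ρ κ e g).adjugate j i * e i := by
  obtain ⟨m, ⟨ι, i1, i2, ρ, κ, e, g, hcard, he, hg, h0⟩, hmax⟩ := exists_max_gram (Γ := Γ)
  refine ⟨ι, i1, i2, ρ, κ, e, g, he, hg, h0, fun w hw f hf ↦ ?_⟩
  set M := gram Γ ρ κ e g with hM
  have hMm : ∀ i j, M i j ∈ MF ⊤ (ρ i + κ j) := gram_mem (fun i ↦ (he i).2) (fun j ↦ (hg j).2)
  set W := ∑ i, ρ i + ∑ j, κ j with hW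
  have hWe : Even W := (Finset.even_sum _ fun i _ ↦ (he i).1).add
    (Finset.even_sum _ fun i _ ↦ (hg i).1)
  have hD : M.det ∈ MF ⊤ W := MF.det hMm
  have hterm : ∀ i j, tr Γ (w + κ j) (f * g j) * M.adjugate j i ∈ MF ⊤ (W + w - ρ i) := fun i j ↦
    MF.congr (by ring) (MF.mul (tr_mem (MF.mul hf (hg j).2)) (MF.adjugate hMm i j))
  have hsum : ∑ i, ∑ j, tr Γ (w + κ j) (f * g j) * M.adjugate j i * e i ∈ MF Γ (W + w) :=
    Submodule.sum_mem _ fun i _ ↦ Submodule.sum_mem _ fun j _ ↦ MF.congr (by ring)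
      (MF.mul (MF_mono le_top (hterm i j)) (he i).2)
  have key : ∀ b, Even b → ∀ x ∈ MF Γ b, tr Γ (W + w + b)
      ((M.det * f - ∑ i, ∑ j, tr Γ (w + κ j) (f * g j) * M.adjugate j i * e i) * x) = 0 := by
    intro b hb x hx
    have hdet : (Matrix.fromBlocks M (gram Γ ρ (fun _ : Unit ↦ b) e (fun _ ↦ x))
        (gram Γ (fun _ : Unit ↦ w) κ (fun _ ↦ f) g)
        (gram Γ (fun _ : Unit ↦ w) (fun _ : Unit ↦ b) (fun _ ↦ f) (fun _ ↦ x))).det = 0 := by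
      by_contra hne
      refine hmax ⟨ι ⊕ Unit, inferInstance, inferInstance, Sum.elim ρ fun _ ↦ w,
        Sum.elim κ fun _ ↦ b, Sum.elim e fun _ ↦ f, Sum.elim g fun _ ↦ x, by simp [hcard], ?_, ?_, ?_⟩
      · rintro (i | i)
        exacts [he i, ⟨hw, hf⟩]
      · rintro (i | i)
        exacts [hg i, ⟨hb, hx⟩]
      · convert hne using 2
        ext (i | i) (j | j) <;> rfl
    have h1 := bordered _ _ _ _ hdet
    have hm1 : ∀ i j, tr Γ (w + κ j) (f * g j) * M.adjugate j i * tr Γ (ρ i + b) (e i * x) =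
        tr Γ (W + w + b) (tr Γ (w + κ j) (f * g j) * M.adjugate j i * e i * x) := fun i j ↦ by
      rw [← tr_mul_level_one (hterm i j), mul_assoc _ (e i) x]
      congr 2
      ring
    have hm2 : M.det * tr Γ (w + b) (f * x) = tr Γ (W + w + b) (M.det * f * x) := by
      rw [← tr_mul_level_one hD, mul_assoc, add_assoc W]
    have h2 : M.det * tr Γ (w + b) (f * x) - ∑ i, ∑ j,
        tr Γ (w + κ j) (f * g j) * M.adjugate j i * tr Γ (ρ i + b) (e i * x) = 0 := by
      have hmd : MDiff (M.det * tr Γ (w + b) (f * x) - ∑ i, ∑ j,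
          tr Γ (w + κ j) (f * g j) * M.adjugate j i * tr Γ (ρ i + b) (e i * x)) := by
        refine (MF.mdiff (k := W + (w + b)) (Γ := ⊤) ?_)
        refine Submodule.sub_mem _ (MF.mul hD (tr_mem (MF.mul hf hx))) ?_
        exact Submodule.sum_mem _ fun i _ ↦ Submodule.sum_mem _ fun j _ ↦ MF.congr (by ring)
          (MF.mul (hterm i j) (tr_mem (MF.mul (he i).2 hx)))
      refine (eq_zero_or_eq_zero (hD.1.pow (Fintype.card ι)) hmd ?_).resolve_left ?_
      · rw [← h1]
        simp [gram, Matrix.mul_apply, Finset.sum_mul]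
      · intro h
        have : ∀ n, M.det ^ n ≠ 0 := fun n ↦ by
          induction n with
          | zero => simp
          | succ n ih =>
            rw [pow_succ]
            intro h
            exact (eq_zero_or_eq_zero (hD.1.pow n) hD.1 h).elim ih h0
        exact this _ h
    rw [sub_mul, map_sub, ← hm2, Finset.sum_mul, map_sum, ← h2]
    congr 1
    refine Finset.sum_congr rfl fun i _ ↦ ?_
    rw [Finset.sum_mul, map_sum]
    exact Finset.sum_congr rfl fun j _ ↦ (hm1 i j).symm
  have hG := Submodule.sub_mem _ (MF.mul (MF_mono le_top hD) hf) hsum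
  refine sub_eq_zero.1 (MF.eq_zero_of_traces hG fun n ↦ ?_)
  have := key _ ((hWe.add hw).mul_left n) _ (MF.pow hG n)
  rw [pow_succ', ← this]
  congr 2
  push_cast; ring

/-- A functional on even weight forms, linear over the level one forms and lowering weights by `k`,
is given by the trace pairing with a cusp form. -/
lemma representation (Λ : ℤ → (ℍ → ℂ) →ₗ[ℂ] (ℍ → ℂ)) (hk : Even k)
    (hΛ : ∀ w, Even w → ∀ f ∈ MF Γ w, Λ w f ∈ MF ⊤ (w - k))
    (h4 : ∀ w, Even w → ∀ f ∈ MF Γ w, Λ (4 + w) (e4 * f) = e4 * Λ w f)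
    (h6 : ∀ w, Even w → ∀ f ∈ MF Γ w, Λ (6 + w) (e6 * f) = e6 * Λ w f) :
    ∃ φ ∈ CF Γ (12 - k), ∀ w, Even w → ∀ f ∈ MF Γ w, tr Γ (12 - k + w) (φ * f) = dl * Λ w f := by
  obtain ⟨ι, i1, i2, ρ, κ, e, g, he, hg, h0, hexp⟩ := exists_gram_expansion (Γ := Γ)
  set M := gram Γ ρ κ e g with hM
  have hMm : ∀ i j, M i j ∈ MF ⊤ (ρ i + κ j) := gram_mem (fun i ↦ (he i).2) (fun j ↦ (hg j).2)
  set W := ∑ i, ρ i + ∑ j, κ j with hW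
  have hWe : Even W := (Finset.even_sum _ fun i _ ↦ (he i).1).add
    (Finset.even_sum _ fun i _ ↦ (hg i).1)
  have hD : M.det ∈ MF ⊤ W := MF.det hMm
  have hc : ∀ i j, M.adjugate j i * Λ (ρ i) (e i) ∈ MF ⊤ (W - k - κ j) := fun i j ↦
    MF.congr (by ring) (MF.mul (MF.adjugate hMm i j) (hΛ _ (he i).1 _ (he i).2))
  set y : ℍ → ℂ := ∑ i, ∑ j, M.adjugate j i * Λ (ρ i) (e i) * g j with hy
  have hym : y ∈ MF Γ (W - k) := Submodule.sum_mem _ fun i _ ↦ Submodule.sum_mem _ fun j _ ↦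
    MF.congr (by ring) (MF.mul (MF_mono le_top (hc i j)) (hg j).2)
  have key : ∀ w, Even w → ∀ f ∈ MF Γ w, tr Γ (W - k + w) (y * f) = M.det * Λ w f := by
    intro w hw f hf
    have h1 := congrArg (Λ (W + w)) (hexp w hw f hf)
    rw [level_one_linear Λ h4 h6 hD hw hf] at h1
    rw [h1, hy, Finset.sum_mul, map_sum, map_sum]
    refine Finset.sum_congr rfl fun i _ ↦ ?_
    rw [Finset.sum_mul, map_sum, map_sum]
    refine Finset.sum_congr rfl fun j _ ↦ ?_
    have h2 : tr Γ (w + κ j) (f * g j) * M.adjugate j i ∈ MF ⊤ (W + w - ρ i) :=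
      MF.congr (by ring) (MF.mul (tr_mem (MF.mul hf (hg j).2)) (MF.adjugate hMm i j))
    have h3 := level_one_linear Λ h4 h6 h2 (he i).1 (he i).2
    rw [sub_add_cancel] at h3
    have h5 := tr_mul_level_one (Γ := Γ) (l := w + κ j) (g := f * g j) (hc i j)
    rw [h3, mul_assoc _ (M.adjugate j i) (Λ (ρ i) (e i)),
      mul_comm _ (M.adjugate j i * Λ (ρ i) (e i)), ← h5, mul_assoc _ (g j), mul_comm (g j)]
    congr 2
    ring
  obtain ⟨φ, hφ, hDφ⟩ := dual hD h0 hym (hWe.sub hk) fun w hw f hf ↦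
    ⟨_, MF.congr (by ring) (hΛ w hw f hf), key w hw f hf⟩
  have hφ' : φ ∈ CF Γ (12 - k) := by
    convert hφ using 2; ring
  refine ⟨φ, hφ', fun w hw f hf ↦ ?_⟩
  refine mul_left_cancel_mdiff h0 hD.1 (tr_mem (MF.mul (CF_le_MF hφ') hf)).1
    (dl_mem.1.mul (hΛ w hw f hf).1) ?_
  rw [mul_left_comm, ← key w hw f hf, ← tr_mul_level_one hD,
    ← tr_mul_level_one (CF_le_MF dl_mem), ← mul_assoc, hDφ, mul_comm y, mul_assoc]
  congr 2
  ring

end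

section

/-! ### Extending a linear functional to a linear map over level one -/

lemma exists_e4_e6_relation {a b : ℍ → ℂ} (ha : a ∈ MF Γ (k - 4)) (hb : b ∈ MF Γ (k - 6))
    (h : e4 * a + e6 * b = 0) : ∃ c ∈ MF Γ (k - 10), a = - (e6 * c) ∧ b = e4 * c := by
  obtain ⟨c, hc, rfl⟩ := e4_simple.exists_eq_mul hb fun z hz ↦ by
    have := congrFun h z
    simp only [Pi.add_apply, Pi.mul_apply, hz, zero_mul, zero_add, Pi.zero_apply] at this
    exact (mul_eq_zero.1 this).resolve_left ((e4_or_e6_ne z).resolve_left (not_not.2 hz))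
  refine ⟨c, MF.congr (by ring) hc, ?_, rfl⟩
  have hm : MDiff (e6 * c) := e6_mem.1.mul hc.1
  refine mul_left_cancel_mdiff e4_simple.ne_zero e4_mem.1 ha.1 hm.neg ?_
  linear_combination h

variable (Γ) in
/-- `L` takes weight `k` forms to level one forms of weight `d`, and is compatible with `A`
and `B` under multiplication by `e4` and `e6`. -/
def IsStep (k d : ℤ) (A B L : (ℍ → ℂ) →ₗ[ℂ] (ℍ → ℂ)) : Prop :=
  (∀ f ∈ MF Γ k, L f ∈ MF ⊤ d) ∧ (∀ f ∈ MF Γ (k - 4), L (e4 * f) = e4 * A f) ∧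
    ∀ f ∈ MF Γ (k - 6), L (e6 * f) = e6 * B f

lemma exists_isStep {d : ℤ} {A B : (ℍ → ℂ) →ₗ[ℂ] (ℍ → ℂ)}
    (hA : ∀ f ∈ MF Γ (k - 4), A f ∈ MF ⊤ (d - 4)) (hB : ∀ f ∈ MF Γ (k - 6), B f ∈ MF ⊤ (d - 6))
    (h : ∀ c ∈ MF Γ (k - 10), e4 * A (e6 * c) = e6 * B (e4 * c)) :
    ∃ L, IsStep Γ k d A B L := by
  let Φ : MF Γ (k - 4) × MF Γ (k - 6) →ₗ[ℂ] (ℍ → ℂ) :=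
    (LinearMap.mulLeft ℂ e4 ∘ₗ (MF Γ (k - 4)).subtype).coprod
      (LinearMap.mulLeft ℂ e6 ∘ₗ (MF Γ (k - 6)).subtype)
  let Ψ₀ : MF Γ (k - 4) × MF Γ (k - 6) →ₗ[ℂ] (ℍ → ℂ) :=
    (LinearMap.mulLeft ℂ e4 ∘ₗ A ∘ₗ (MF Γ (k - 4)).subtype).coprod
      (LinearMap.mulLeft ℂ e6 ∘ₗ B ∘ₗ (MF Γ (k - 6)).subtype)
  have hΨ : ∀ x, Ψ₀ x ∈ MF ⊤ d := fun x ↦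
    add_mem (MF.congr (by ring) (MF.mul e4_mem (hA _ x.1.2)))
      (MF.congr (by ring) (MF.mul e6_mem (hB _ x.2.2)))
  let Ψ : MF Γ (k - 4) × MF Γ (k - 6) →ₗ[ℂ] MF ⊤ d := Ψ₀.codRestrict _ hΨ
  have hker : LinearMap.ker Φ ≤ LinearMap.ker Ψ := by
    rintro ⟨a, b⟩ hx
    obtain ⟨c, hc, h1, h2⟩ := exists_e4_e6_relation a.2 b.2 hx
    refine Subtype.ext ?_
    change e4 * A a + e6 * B b = 0
    rw [h1, h2, map_neg, mul_neg, h c hc, neg_add_cancel]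
  obtain ⟨s, hs⟩ := ((LinearMap.ker Φ).liftQ Φ le_rfl).exists_leftInverse_of_injective
    (Submodule.ker_liftQ_eq_bot _ _ _ le_rfl)
  let L : (ℍ → ℂ) →ₗ[ℂ] (ℍ → ℂ) :=
    (MF ⊤ d).subtype ∘ₗ (LinearMap.ker Φ).liftQ Ψ hker ∘ₗ s
  have hL : ∀ x, L (Φ x) = Ψ₀ x := fun x ↦ by
    have := LinearMap.congr_fun hs (Submodule.Quotient.mk x)
    simp only [LinearMap.comp_apply, Submodule.liftQ_apply, LinearMap.id_apply] at this
    simp only [L, LinearMap.comp_apply, this, Submodule.liftQ_apply]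
    rfl
  refine ⟨L, fun f _ ↦ Subtype.property _, fun f hf ↦ ?_, fun f hf ↦ ?_⟩
  · have := hL (⟨f, hf⟩, 0)
    simpa [Φ, Ψ₀] using this
  · have := hL (0, ⟨f, hf⟩)
    simpa [Φ, Ψ₀] using this

open Classical in
variable (Γ) in
/-- A choice of linear map extending `A` and `B`. -/
def step (k d : ℤ) (A B : (ℍ → ℂ) →ₗ[ℂ] (ℍ → ℂ)) : (ℍ → ℂ) →ₗ[ℂ] (ℍ → ℂ) :=
  if h : ∃ L, IsStep Γ k d A B L then h.choose else 0

lemma step_spec {d : ℤ} {A B : (ℍ → ℂ) →ₗ[ℂ] (ℍ → ℂ)} (h : ∃ L, IsStep Γ k d A B L) :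
    IsStep Γ k d A B (step Γ k d A B) := by
  rw [step, dif_pos h]
  exact h.choose_spec

variable (Γ) in
/-- The extension of a map `L₀` of weight `k` forms to constants, to all weights: index `n`
corresponds to weight `k - 6 + 2 * n`. -/
def extSeq (k : ℤ) (L₀ : (ℍ → ℂ) →ₗ[ℂ] (ℍ → ℂ)) : ℕ → ((ℍ → ℂ) →ₗ[ℂ] (ℍ → ℂ))
  | 0 => 0
  | 1 => 0
  | 2 => 0
  | 3 => L₀
  | n + 4 => step Γ (k + 2 * (n + 1)) (2 * (n + 1)) (extSeq k L₀ (n + 2)) (extSeq k L₀ (n + 1))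

lemma extSeq_isStep {L₀ : (ℍ → ℂ) →ₗ[ℂ] (ℍ → ℂ)} (hL : ∀ f ∈ MF Γ k, L₀ f ∈ MF ⊤ 0)
    (h4 : ∀ f ∈ MF Γ (k - 4), L₀ (e4 * f) = 0) (h6 : ∀ f ∈ MF Γ (k - 6), L₀ (e6 * f) = 0)
    (n : ℕ) : IsStep Γ (k + 2 * n) (2 * n) (extSeq Γ k L₀ (n + 1)) (extSeq Γ k L₀ n)
      (extSeq Γ k L₀ (n + 3)) := by
  induction n using Nat.strong_induction_on with
  | _ n ih =>
  match n with
  | 0 =>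
    refine ⟨fun f hf ↦ ?_, fun f hf ↦ ?_, fun f hf ↦ ?_⟩
    · exact MF.congr (by simp) (hL f (MF.congr (by simp) hf))
    · simp [extSeq, h4 f (MF.congr (by simp) hf)]
    · simp [extSeq, h6 f (MF.congr (by simp) hf)]
  | n + 1 =>
    have hmem : ∀ m < n + 4, ∀ f ∈ MF Γ (k - 6 + 2 * m), extSeq Γ k L₀ m f ∈ MF ⊤ (2 * m - 6) := by
      intro m hm f hf
      rcases lt_or_ge m 3 with h | h
      · interval_cases m <;> exact zero_mem _
      · obtain ⟨m, rfl⟩ := Nat.exists_eq_add_of_le' h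
        exact MF.congr (by push_cast; ring) ((ih m (by omega)).1 f (MF.congr (by push_cast; ring) hf))
    have hex : ∃ L, IsStep Γ (k + 2 * (n + 1)) (2 * (n + 1)) (extSeq Γ k L₀ (n + 2))
        (extSeq Γ k L₀ (n + 1)) L := by
      refine exists_isStep (fun f hf ↦ ?_) (fun f hf ↦ ?_) fun c hc ↦ ?_
      · exact MF.congr (by push_cast; ring) (hmem _ (by omega) f (MF.congr (by push_cast; ring) hf))
      · exact MF.congr (by push_cast; ring) (hmem _ (by omega) f (MF.congr (by push_cast; ring) hf))
      · match n with
        | 0 => simp [extSeq]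
        | 1 =>
          have h1 := (ih 0 (by omega)).2.2 c (MF.congr (by push_cast; ring) hc)
          simp only [extSeq] at h1 ⊢
          simp [h1]
        | n + 2 =>
          have h1 := (ih (n + 1) (by omega)).2.2 c (MF.congr (by push_cast; ring) hc)
          have h2 := (ih n (by omega)).2.1 c (MF.congr (by push_cast; ring) hc)
          rw [h1, h2]
          ring
    have := step_spec hex
    exact_mod_cast this

lemma exists_extension (hk : Even k) {L₀ : (ℍ → ℂ) →ₗ[ℂ] (ℍ → ℂ)}
    (hL : ∀ f ∈ MF Γ k, L₀ f ∈ MF ⊤ 0)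
    (h4 : ∀ f ∈ MF Γ (k - 4), L₀ (e4 * f) = 0) (h6 : ∀ f ∈ MF Γ (k - 6), L₀ (e6 * f) = 0) :
    ∃ Λ : ℤ → (ℍ → ℂ) →ₗ[ℂ] (ℍ → ℂ), Λ k = L₀ ∧
      (∀ w, Even w → ∀ f ∈ MF Γ w, Λ w f ∈ MF ⊤ (w - k)) ∧
      (∀ w, Even w → ∀ f ∈ MF Γ w, Λ (4 + w) (e4 * f) = e4 * Λ w f) ∧
      (∀ w, Even w → ∀ f ∈ MF Γ w, Λ (6 + w) (e6 * f) = e6 * Λ w f) := by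
  have hs := extSeq_isStep hL h4 h6
  have hidx : ∀ (w : ℤ) (m : ℕ), w = k - 6 + 2 * m → ((w - k + 6) / 2).toNat = m := by
    intro w m h; omega
  have hneg : ∀ w : ℤ, w < k → Even w → extSeq Γ k L₀ ((w - k + 6) / 2).toNat = 0 := by
    rintro w hw ⟨v, rfl⟩
    obtain ⟨u, rfl⟩ := hk
    have : ((v + v - (u + u) + 6) / 2).toNat < 3 := by omega
    interval_cases ((v + v - (u + u) + 6) / 2).toNat <;> rfl
  have hnn : ∀ w : ℤ, Even w → k ≤ w → ∃ n : ℕ, w = k + 2 * n := by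
    rintro w ⟨v, rfl⟩ hw
    obtain ⟨u, rfl⟩ := hk
    exact ⟨(v - u).toNat, by omega⟩
  refine ⟨fun w ↦ extSeq Γ k L₀ ((w - k + 6) / 2).toNat, ?_, fun w hw f hf ↦ ?_,
    fun w hw f hf ↦ ?_, fun w hw f hf ↦ ?_⟩
  · change extSeq Γ k L₀ ((k - k + 6) / 2).toNat = L₀
    rw [hidx k 3 (by ring)]; rfl
  · rcases lt_or_ge w k with h | h
    · change extSeq Γ k L₀ _ f ∈ _
      rw [hneg w h hw]; exact zero_mem _
    · obtain ⟨n, rfl⟩ := hnn w hw h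
      change extSeq Γ k L₀ _ f ∈ _
      rw [hidx _ (n + 3) (by push_cast; ring)]
      exact MF.congr (by ring) ((hs n).1 f hf)
  · change extSeq Γ k L₀ _ _ = e4 * extSeq Γ k L₀ _ f
    rcases lt_or_ge (4 + w) k with h | h
    · rw [hneg _ h (by rw [Int.even_add]; exact iff_of_true (by decide) hw),
        hneg w (by omega) hw]; simp
    · obtain ⟨n, hn⟩ := hnn (4 + w) (by rw [Int.even_add]; exact iff_of_true (by decide) hw) h
      rw [hidx _ (n + 3) (by push_cast; omega), hidx w (n + 1) (by push_cast; omega)]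
      exact (hs n).2.1 f (MF.congr (by omega) hf)
  · change extSeq Γ k L₀ _ _ = e6 * extSeq Γ k L₀ _ f
    rcases lt_or_ge (6 + w) k with h | h
    · rw [hneg _ h (by rw [Int.even_add]; exact iff_of_true (by decide) hw),
        hneg w (by omega) hw]; simp
    · obtain ⟨n, hn⟩ := hnn (6 + w) (by rw [Int.even_add]; exact iff_of_true (by decide) hw) h
      rw [hidx _ (n + 3) (by push_cast; omega), hidx w n (by omega)]
      exact (hs n).2.2 f (MF.congr (by omega) hf)

end

section

lemma eq_mul_pow_e4 {ψ x : ℍ → ℂ} (hψ : ψ ∈ MF Γ 4) (hx : MDiff x) (hx0 : x ≠ 0)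
    (h : ∀ n : ℕ, ∃ g : ℍ → ℂ, MDiff g ∧ ψ ^ n * x = e4 ^ n * g) : ∃ c ∈ MF Γ (4 - 4), ψ = e4 * c := by
  refine e4_simple.exists_eq_mul hψ fun z hz ↦ ?_
  by_contra hψz
  have han : ∀ {f : ℍ → ℂ}, MDiff f → AnalyticAt ℂ (f ∘ ofComplex) z := fun hf ↦
    (UpperHalfPlane.mdifferentiable_iff.1 hf).analyticAt (isOpen_upperHalfPlaneSet.mem_nhds z.2)
  have hfin : analyticOrderAt (x ∘ ofComplex) z ≠ ⊤ := by
    intro ht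
    rw [analyticOrderAt_eq_top] at ht
    refine hx0 (funext fun τ ↦ ?_)
    have := ((UpperHalfPlane.mdifferentiable_iff.1 hx).analyticOnNhd
      isOpen_upperHalfPlaneSet).eqOn_zero_of_preconnected_of_eventuallyEq_zero
      (convex_halfSpace_im_gt 0).isPreconnected z.2 ht τ.2
    simpa using this
  obtain ⟨m, hm⟩ := ENat.ne_top_iff_exists.1 hfin
  obtain ⟨g, hg, he⟩ := h (m + 1)
  have hz' : (e4 ∘ ofComplex) z = 0 := by simpa using hz
  have hψz' : (ψ ∘ ofComplex) z ≠ 0 := by simpa using hψz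
  have h4 : 1 ≤ analyticOrderAt (e4 ∘ ofComplex) z := by
    rw [Order.one_le_iff_ne_zero, (han e4_mem.1).analyticOrderAt_ne_zero]
    exact hz'
  have hψo : analyticOrderAt (ψ ∘ ofComplex) z = 0 := by
    rw [(han hψ.1).analyticOrderAt_eq_zero]
    exact hψz'
  have he' : (ψ ∘ ofComplex) ^ (m + 1) * (x ∘ ofComplex) =
      (e4 ∘ ofComplex) ^ (m + 1) * (g ∘ ofComplex) :=
    funext fun τ ↦ congrFun he (ofComplex τ)
  have ho := congrArg (fun F ↦ analyticOrderAt F (z : ℂ)) he'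
  rw [analyticOrderAt_mul ((han hψ.1).pow _) (han hx),
    analyticOrderAt_mul ((han e4_mem.1).pow _) (han hg), analyticOrderAt_pow (han hψ.1),
    analyticOrderAt_pow (han e4_mem.1), hψo, smul_zero, zero_add, ← hm] at ho
  have : ((m + 1 : ℕ) : ℕ∞) ≤ m := by
    rw [ho]
    refine le_add_right ?_
    calc ((m + 1 : ℕ) : ℕ∞) = (m + 1) • 1 := by simp
      _ ≤ _ := nsmul_le_nsmul_right h4 _
  norm_cast at this
  omega

lemma MF.zero : (0 : ℍ → ℂ) ∈ MF Γ k := Submodule.zero_mem _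

lemma CF.congr {a b : ℤ} (h : a = b) (hf : f ∈ CF Γ a) : f ∈ CF Γ b := h ▸ hf

variable [Γ.FiniteIndex]

lemma eq_zero_of_pow_mul_eq {ψ x : ℍ → ℂ} (hψ : ψ ∈ CF Γ 4) (hx : MDiff x) (hx0 : x ≠ 0)
    (h : ∀ n : ℕ, ∃ g : ℍ → ℂ, MDiff g ∧ ψ ^ n * x = e4 ^ n * g) : ψ = 0 := by
  obtain ⟨c, hc, rfl⟩ := eq_mul_pow_e4 (CF_le_MF hψ) hx hx0 h
  have hc' : c ∈ CF Γ 0 := e4_simple.cusp (MF.congr (by norm_num) hc) hψ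
  rw [CF_nonpos hc' le_rfl, mul_zero]

/-- A functional on forms of weight `k` that kills multiples of `e4` and `e6` is the trace pairing
with a cusp form of weight `12 - k`. -/
lemma functional_eq_trace (hk : Even k) (L : (ℍ → ℂ) →ₗ[ℂ] ℂ)
    (h4 : ∀ f ∈ MF Γ (k - 4), L (e4 * f) = 0) (h6 : ∀ f ∈ MF Γ (k - 6), L (e6 * f) = 0) :
    ∃ φ ∈ CF Γ (12 - k), ∀ f ∈ MF Γ k, tr Γ 12 (φ * f) = L f • dl := by
  obtain ⟨Λ, h0, h1, h2, h3⟩ := exists_extension (Γ := Γ) hk (L₀ := L.smulRight 1)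
    (fun f _ ↦ Submodule.smul_mem _ _ MF_one) (fun f hf ↦ by simp [h4 f hf])
    (fun f hf ↦ by simp [h6 f hf])
  obtain ⟨φ, hφ, h⟩ := representation Λ hk h1 h2 h3
  refine ⟨φ, hφ, fun f hf ↦ ?_⟩
  have := h k hk f hf
  rw [sub_add_cancel, h0] at this
  rw [this, LinearMap.smulRight_apply, mul_smul_comm, mul_one]

lemma mem_of_trace {S : Submodule ℂ (ℍ → ℂ)} (hk : Even k)
    (h4 : ∀ f ∈ MF Γ (k - 4), e4 * f ∈ S) (h6 : ∀ f ∈ MF Γ (k - 6), e6 * f ∈ S)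
    (H : ∀ φ ∈ CF Γ (12 - k), (∀ f ∈ MF Γ k, f ∈ S → tr Γ 12 (φ * f) = 0) → φ = 0)
    (hf : f ∈ MF Γ k) : f ∈ S := by
  by_contra hfS
  obtain ⟨L, hL, hS⟩ := Submodule.exists_le_ker_of_notMem hfS
  obtain ⟨φ, hφ, h⟩ := functional_eq_trace hk L (fun f hf ↦ hS (h4 f hf)) (fun f hf ↦ hS (h6 f hf))
  have h0 := H φ hφ fun g hg hgS ↦ by
    rw [h g hg, show L g = 0 from hS hgS, zero_smul]
  have := h f hf
  rw [h0, zero_mul, map_zero] at this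
  exact (smul_ne_zero hL dl_ne_zero) this.symm

/-- Forms of weight `k` are combinations of `e4` and `e6` if there are no cusp forms of weight
`12 - k`. -/
lemma exists_e4_e6 (hk : Even k) (hS : ∀ φ ∈ CF Γ (12 - k), φ = 0) (hf : f ∈ MF Γ k) :
    ∃ a ∈ MF Γ (k - 4), ∃ b ∈ MF Γ (k - 6), f = e4 * a + e6 * b := by
  have := mem_of_trace (S := (MF Γ (k - 4)).map (LinearMap.mulLeft ℂ e4) ⊔
    (MF Γ (k - 6)).map (LinearMap.mulLeft ℂ e6)) hk
    (fun f hf ↦ Submodule.mem_sup_left ⟨f, hf, rfl⟩)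
    (fun f hf ↦ Submodule.mem_sup_right ⟨f, hf, rfl⟩) (fun φ hφ _ ↦ hS φ hφ) hf
  obtain ⟨_, ⟨a, ha, rfl⟩, _, ⟨b, hb, rfl⟩, rfl⟩ := Submodule.mem_sup.1 this
  exact ⟨a, ha, b, hb, rfl⟩

lemma exists_e4_e6_of_le (hk : Even k) (h12 : 12 ≤ k) (hf : f ∈ MF Γ k) :
    ∃ a ∈ MF Γ (k - 4), ∃ b ∈ MF Γ (k - 6), f = e4 * a + e6 * b :=
  exists_e4_e6 hk (fun _ hφ ↦ CF_nonpos hφ (by omega)) hf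

lemma exists_eq_e4_mul {χ : ℍ → ℂ} (hl : Even l) (hχ : χ ∈ CF Γ l)
    (h0 : ∀ x ∈ MF Γ (12 - l), tr Γ 12 (χ * x) = 0)
    (hgen : ∀ n : ℕ, ∀ f ∈ MF Γ (18 - l + 6 * n), ∃ a ∈ MF Γ (18 - l + 6 * n - 4),
      ∃ b ∈ MF Γ (18 - l + 6 * n - 6), f = e4 * a + e6 * b) :
    ∃ ψ ∈ CF Γ (l - 4), χ = e4 * ψ := by
  have hdl : ∀ {w : ℤ} {f : ℍ → ℂ}, f ∈ MF Γ w →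
      ∃ g ∈ MF ⊤ (l + w - 12), tr Γ (l + w) (χ * f) = dl * g := fun hf ↦
    CF_top_eq (tr_mem_cusp (CF.mul hχ hf))
  have hsix : ∀ n : ℕ, ∀ f ∈ MF Γ (12 - l + 6 * n),
      ∃ h ∈ MF ⊤ (6 * n - 4), tr Γ (12 + 6 * n) (χ * f) = e4 * dl * h := by
    intro n
    induction n with
    | zero =>
      intro f hf
      refine ⟨0, MF.zero, ?_⟩
      have := h0 f (MF.congr (by simp) hf)
      simpa using this
    | succ n ih =>
      intro f hf
      obtain ⟨a, ha, b, hb, rfl⟩ := hgen n f (MF.congr (by push_cast; ring) hf)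
      obtain ⟨g, hg, hga⟩ := hdl ha
      obtain ⟨h, hh, hhb⟩ := ih b (MF.congr (by ring) hb)
      have m1 : g ∈ MF ⊤ (6 * (n + 1 : ℕ) - 4) := MF.congr (by push_cast; ring) hg
      have m2 : e6 * h ∈ MF ⊤ (6 * (n + 1 : ℕ) - 4) :=
        MF.congr (by push_cast; ring) (MF.mul e6_mem hh)
      refine ⟨g + e6 * h, Submodule.add_mem _ m1 m2, ?_⟩
      have e1 : tr Γ (12 + 6 * (n + 1 : ℕ)) (e4 * (χ * a)) = e4 * (dl * g) := by
        rw [← hga, ← tr_mul_level_one e4_mem]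
        congr 2; push_cast; ring
      have e2 : tr Γ (12 + 6 * (n + 1 : ℕ)) (e6 * (χ * b)) = e6 * (e4 * dl * h) := by
        rw [← hhb, ← tr_mul_level_one e6_mem]
        congr 2; push_cast; ring
      rw [show χ * (e4 * a + e6 * b) = e4 * (χ * a) + e6 * (χ * b) by ring, map_add, e1, e2]
      ring
  have hD : e4 * dl ∈ MF ⊤ 16 := MF.congr (by norm_num) (MF.mul e4_mem (CF_le_MF dl_mem))
  have hD0 : e4 * dl ≠ 0 := fun h ↦
    (eq_zero_or_eq_zero e4_mem.1 dl_mem.1 h).elim e4_simple.ne_zero dl_ne_zero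
  obtain ⟨φ, hφ, h⟩ := dual hD hD0 (CF_le_MF hχ) hl fun w hw f hf ↦ by
    obtain ⟨g, hg, hgt⟩ := hdl hf
    rcases lt_or_ge (l + w - 12) 0 with hneg | hnn
    · refine ⟨0, MF.zero, ?_⟩
      rw [hgt, MF_neg hg hneg, mul_zero, mul_zero]
    obtain ⟨m, hm⟩ : ∃ m : ℕ, l + w - 12 = 2 * m := by
      obtain ⟨a, rfl⟩ := hl
      obtain ⟨b, rfl⟩ := hw
      exact ⟨(a + b - 6).toNat, by omega⟩
    by_cases h3 : 3 ∣ m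
    · obtain ⟨n, rfl⟩ := h3
      obtain ⟨h, hh, he⟩ := hsix n f (MF.congr (by push_cast at hm; omega) hf)
      refine ⟨h, MF.congr (by push_cast at hm; omega) hh, ?_⟩
      rw [← he]
      congr 2; push_cast at hm; omega
    · obtain ⟨D, hD, rfl⟩ := reduce_e4_of_not h3 (MF.congr hm hg)
      exact ⟨D, MF.congr (by omega) hD, by rw [hgt]; ring⟩
  have hφ' : φ ∈ CF Γ (l - 4) := by
    rwa [show l - 16 + 12 = l - 4 by ring] at hφ
  refine ⟨φ, hφ', mul_left_cancel_mdiff dl_ne_zero dl_mem.1 hχ.1 (e4_mem.1.mul hφ.1) ?_⟩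
  linear_combination -h

lemma exists_eq_e4_mul_of_six {χ : ℍ → ℂ} (hχ : χ ∈ CF Γ 6)
    (h0 : ∀ x ∈ MF Γ 6, tr Γ 12 (χ * x) = 0) : ∃ ψ ∈ CF Γ (6 - 4), χ = e4 * ψ :=
  exists_eq_e4_mul (by decide) hχ (fun x hx ↦ h0 x (MF.congr (by norm_num) hx))
    (fun n _ hf ↦ exists_e4_e6_of_le ⟨6 + 3 * n, by ring⟩ (by omega) hf)

/-- Forms of weight ten are combinations of products of forms of weights four and six. -/
lemma MF_ten {S : Submodule ℂ (ℍ → ℂ)} (h46 : ∀ a ∈ MF Γ 4, ∀ b ∈ MF Γ 6, a * b ∈ S)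
    (hf : f ∈ MF Γ 10) : f ∈ S := by
  refine mem_of_trace (by decide) (fun f hf ↦ h46 _ e4_mem' _ (MF.congr (by norm_num) hf))
    (fun f hf ↦ mul_comm f e6 ▸ h46 _ (MF.congr (by norm_num) hf) _ e6_mem') (fun φ hφ h ↦ ?_) hf
  replace hφ : φ ∈ CF Γ 2 := CF.congr (by norm_num) hφ
  have key : ∀ x ∈ MF Γ 4, ∃ ψ ∈ CF Γ 2, φ * x = e4 * ψ := fun x hx ↦ by
    obtain ⟨ψ, hψ, he⟩ := exists_eq_e4_mul_of_six (χ := φ * x)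
      (CF.congr (by norm_num) (CF.mul hφ hx)) fun y hy ↦ by
        rw [mul_assoc]
        exact h _ (MF.congr (by norm_num) (MF.mul hx hy)) (h46 _ hx _ hy)
    exact ⟨ψ, CF.congr (by norm_num) hψ, he⟩
  by_contra hφ0
  have hsq : φ * φ = 0 := by
    refine eq_zero_of_pow_mul_eq (CF.congr (by norm_num) (CF.mul hφ (CF_le_MF hφ))) hφ.1 hφ0
      fun n ↦ ?_
    suffices ∃ g ∈ CF Γ 2, (φ * φ) ^ n * φ = e4 ^ n * g from
      let ⟨g, hg, he⟩ := this; ⟨g, hg.1, he⟩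
    induction n with
    | zero => exact ⟨φ, hφ, by simp⟩
    | succ n ih =>
      obtain ⟨g, hg, he⟩ := ih
      obtain ⟨ψ, hψ, hψe⟩ := key (φ * g)
        (MF.congr (by norm_num) (CF_le_MF (CF.mul hφ (CF_le_MF hg))))
      exact ⟨ψ, hψ, by linear_combination φ * φ * he + e4 ^ n * hψe⟩
  exact hφ0 ((eq_zero_or_eq_zero hφ.1 hφ.1 hsq).elim id id)

/-- Forms of weight eight are combinations of products of forms of smaller weights. -/
lemma MF_eight {S : Submodule ℂ (ℍ → ℂ)} (h44 : ∀ a ∈ MF Γ 4, ∀ b ∈ MF Γ 4, a * b ∈ S)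
    (h26 : ∀ a ∈ MF Γ 2, ∀ b ∈ MF Γ 6, a * b ∈ S) (hf : f ∈ MF Γ 8) : f ∈ S := by
  refine mem_of_trace (by decide) (fun f hf ↦ h44 _ e4_mem' _ (MF.congr (by norm_num) hf))
    (fun f hf ↦ mul_comm f e6 ▸ h26 _ (MF.congr (by norm_num) hf) _ e6_mem') (fun φ hφ h ↦ ?_) hf
  replace hφ : φ ∈ CF Γ 4 := CF.congr (by norm_num) hφ
  by_cases h2 : ∃ x ∈ MF Γ 2, x ≠ 0
  · obtain ⟨x, hx, hx0⟩ := h2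
    refine eq_zero_of_pow_mul_eq hφ hx.1 hx0 fun n ↦ ?_
    suffices ∃ g ∈ MF Γ 2, φ ^ n * x = e4 ^ n * g from
      let ⟨g, hg, he⟩ := this; ⟨g, hg.1, he⟩
    induction n with
    | zero => exact ⟨x, hx, by simp⟩
    | succ n ih =>
      obtain ⟨g, hg, he⟩ := ih
      obtain ⟨ψ, hψ, hψe⟩ := exists_eq_e4_mul_of_six (χ := φ * g)
        (CF.congr (by norm_num) (CF.mul hφ hg)) fun y hy ↦ by
          rw [mul_assoc]
          exact h _ (MF.congr (by norm_num) (MF.mul hg hy)) (h26 _ hg _ hy)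
      exact ⟨ψ, MF.congr (by norm_num) (CF_le_MF hψ), by linear_combination φ * he + e4 ^ n * hψe⟩
  · push Not at h2
    refine eq_zero_of_pow_mul_eq hφ e4_mem.1 e4_simple.ne_zero fun n ↦ ?_
    suffices ∃ g ∈ MF Γ 4, φ ^ n * e4 = e4 ^ n * g from
      let ⟨g, hg, he⟩ := this; ⟨g, hg.1, he⟩
    induction n with
    | zero => exact ⟨e4, e4_mem', by simp⟩
    | succ n ih =>
      obtain ⟨g, hg, he⟩ := ih
      obtain ⟨ψ, hψ, hψe⟩ := exists_eq_e4_mul (χ := φ * g) (l := 8) (by decide)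
        (CF.congr (by norm_num) (CF.mul hφ hg)) (fun y hy ↦ by
          replace hy : y ∈ MF Γ 4 := MF.congr (by norm_num) hy
          rw [mul_assoc]
          exact h _ (MF.congr (by norm_num) (MF.mul hg hy)) (h44 _ hg _ hy)) fun n f hf ↦ by
            refine exists_e4_e6 ⟨5 + 3 * n, by ring⟩ (fun ψ hψ ↦ ?_) hf
            rcases n with _ | n
            · exact h2 ψ (MF.congr (by norm_num) (CF_le_MF hψ))
            · exact CF_nonpos hψ (by push_cast; omega)
      exact ⟨ψ, MF.congr (by norm_num) (CF_le_MF hψ), by linear_combination φ * he + e4 ^ n * hψe⟩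

end

section

/-! ### Generation in low weight -/

variable (Γ) in
/-- The span of the products of forms of weights two, four and six with total weight `k`. -/
def lowSpan (k : ℤ) : Submodule ℂ (ℍ → ℂ) :=
  Submodule.span ℂ {F | ∃ (r : ℕ) (w : Fin r → ℤ) (g : Fin r → ℍ → ℂ),
    (∀ j, w j = 2 ∨ w j = 4 ∨ w j = 6) ∧ (∀ j, g j ∈ MF Γ (w j)) ∧ ∑ j, w j = k ∧ F = ∏ j, g j}

lemma MF_le_lowSpan (hk : k = 2 ∨ k = 4 ∨ k = 6) : MF Γ k ≤ lowSpan Γ k := fun f hf ↦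
  Submodule.subset_span ⟨1, fun _ ↦ k, fun _ ↦ f, fun _ ↦ hk, fun _ ↦ hf, by simp, by simp⟩

lemma mul_mem_lowSpan (hl : l = 2 ∨ l = 4 ∨ l = 6) (hf : f ∈ MF Γ l) (hg : g ∈ lowSpan Γ k) :
    f * g ∈ lowSpan Γ (l + k) := by
  refine Submodule.span_induction (fun F hF ↦ ?_) ?_ (fun x y _ _ hx hy ↦ ?_)
    (fun c x _ hx ↦ ?_) hg
  · obtain ⟨r, w, g, hw, hg, hs, rfl⟩ := hF
    refine Submodule.subset_span ⟨r + 1, Fin.cons l w, Fin.cons f g, ?_, ?_, ?_, ?_⟩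
    · exact Fin.cases hl hw
    · exact Fin.cases hf hg
    · rw [Fin.sum_cons, hs]
    · rw [Fin.prod_cons]
  · rw [mul_zero]; exact Submodule.zero_mem _
  · rw [mul_add]; exact Submodule.add_mem _ hx hy
  · rw [mul_smul_comm]; exact Submodule.smul_mem _ _ hx

theorem MF_le_lowSpan_of_even [Γ.FiniteIndex] (n : ℕ) :
    MF Γ (2 * (n + 1)) ≤ lowSpan Γ (2 * (n + 1)) := by
  induction n using Nat.strong_induction_on with
  | _ n ih =>
    have hmul : ∀ {a b : ℤ}, (a = 2 ∨ a = 4 ∨ a = 6) → a + b = 2 * (n + 1) → 2 ≤ b →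
        ∀ {x y}, x ∈ MF Γ a → y ∈ MF Γ b → x * y ∈ lowSpan Γ (2 * (n + 1)) := by
      intro a b ha hab hb x y hx hy
      have hm : b = 2 * ((n - (a / 2).toNat : ℕ) + 1) := by omega
      have hy' := ih (n - (a / 2).toNat) (by omega) (MF.congr hm hy)
      rw [← hm] at hy'
      rw [← hab]
      exact mul_mem_lowSpan ha hx hy'
    intro f hf
    by_cases h6 : n ≤ 2
    · exact MF_le_lowSpan (by omega) hf
    by_cases h8 : n = 3
    · subst h8
      exact MF_eight (fun a ha b hb ↦ hmul (by norm_num) (by norm_num) (by norm_num) ha hb)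
        (fun a ha b hb ↦ hmul (by norm_num) (by norm_num) (by norm_num) ha hb)
        (MF.congr (by norm_num) hf)
    by_cases h10 : n = 4
    · subst h10
      exact MF_ten (fun a ha b hb ↦ hmul (by norm_num) (by norm_num) (by norm_num) ha hb)
        (MF.congr (by norm_num) hf)
    obtain ⟨a, ha, b, hb, rfl⟩ := exists_e4_e6_of_le (even_two_mul _) (by omega) hf
    exact Submodule.add_mem _ (hmul (by norm_num) (by ring) (by omega) e4_mem' ha)
      (hmul (by norm_num) (by ring) (by omega) e6_mem' hb)

end

end

end LowWeight

/-- For every positive integer `N` and even `k ≥ 2`, every `f ∈ M_k(Γ0(N))` is a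
`ℂ`-linear combination of products `g_1 ⋯ g_r` of modular forms on `Γ0(N)` whose
weights lie in `{2, 4, 6}` and sum to `k`: the graded ring of modular forms on
`Γ0(N)` is generated in weight at most `6`. -/
theorem generated_in_weight_le_six
    (N : ℕ) (hN : 0 < N) (k : ℤ) (hk : 2 ≤ k) (hke : Even k)
    (f : ModularForm (Gamma0 N) k) :
    (⇑f : UpperHalfPlane → ℂ) ∈ Submodule.span ℂ
      {F : UpperHalfPlane → ℂ |
        ∃ (r : ℕ) (w : Fin r → ℤ) (g : (j : Fin r) → ModularForm (Gamma0 N) (w j)),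
          (∀ j, w j = 2 ∨ w j = 4 ∨ w j = 6) ∧ (∑ j, w j) = k ∧
          F = fun z => ∏ j, g j z} := by
  have : NeZero N := ⟨hN.ne'⟩
  obtain ⟨n, rfl⟩ : ∃ n : ℕ, k = 2 * (n + 1) := by
    obtain ⟨m, rfl⟩ := hke
    exact ⟨(m - 1).toNat, by omega⟩
  refine Submodule.span_mono ?_ (LowWeight.MF_le_lowSpan_of_even n (LowWeight.mem_MF f))
  rintro _ ⟨r, w, g, hw, hg, hs, rfl⟩
  refine ⟨r, w, fun j ↦ LowWeight.MF.toModularForm (hg j), hw, hs, ?_⟩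
  ext z
  rw [Finset.prod_apply]
  rfl
end
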